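/- arXiv:1806.02524 — 3 statements merged into one kernel-verified Lean document; each statement's English description precedes it below -/
import Mathlib

section
/- For every category 𝒦, the following three conditions are equivalent: (i) the free coproduct completion Σ𝒦 is extensive; (ii) Σ𝒦 is infinitary extensive; (iii) 𝒦 is finitely multi-complete. -/
/- Common definitions for formalizing "How nice are free completions of categories?"
   by Adámek and Rosický. -/

open CategoryTheory CategoryTheory.Limits

universe w w₁ w₂ v₁ u₁

namespace FreeCompletions

/-- A presheaf is *small* if it is a colimit of representables over a small
(`Type w`-indexed) diagram. -/
def IsSmallPresheaf {C : Type u₁} [Category.{v₁} C] (F : Cᵒᵖ ⥤ Type v₁) : Prop :=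
  ∃ (J : Type w) (_ : SmallCategory J) (D : J ⥤ C) (c : Cocone (D ⋙ yoneda)),
    Nonempty (IsColimit c) ∧ Nonempty (c.pt ≅ F)

/-- A presheaf is a (small) coproduct of representables. -/
def IsCoproductOfRepresentables {C : Type u₁} [Category.{v₁} C] (F : Cᵒᵖ ⥤ Type v₁) : Prop :=
  ∃ (I : Type v₁) (A : I → C), Nonempty (F ≅ ∐ fun i => yoneda.obj (A i))

/-- The free coproduct completion `Σ𝒦`, realized as the full subcategory of presheaves
consisting of coproducts of representables. -/
abbrev SigmaCompletion (K : Type u₁) [Category.{v₁} K] :=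
  ObjectProperty.FullSubcategory (IsCoproductOfRepresentables (C := K))

/-- The free colimit completion `𝒫𝒦`, the full subcategory of presheaves
consisting of the small presheaves. -/
abbrev PCompletion (K : Type u₁) [Category.{v₁} K] :=
  ObjectProperty.FullSubcategory (IsSmallPresheaf.{v₁} (C := K))

/-- The object of `Σ𝒦` given by a small family of objects of `𝒦`. -/
noncomputable def famObj {K : Type u₁} [Category.{v₁} K] {I : Type v₁} (B : I → K) :
    SigmaCompletion K :=
  ⟨∐ fun i => yoneda.obj (B i), ⟨I, B, ⟨Iso.refl _⟩⟩⟩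

theorem isSmallPresheaf_coprod {K : Type u₁} [Category.{v₁} K] {I : Type v₁} (B : I → K) :
    IsSmallPresheaf.{v₁} (∐ fun i => yoneda.obj (B i)) := by
  let G := Discrete.functor (fun i => yoneda.obj (B i))
  let e : Discrete.functor B ⋙ yoneda ≅ G := Discrete.natIso (fun i => Iso.refl _)
  exact ⟨Discrete I, inferInstance, Discrete.functor B,
    (Cocone.precompose e.hom).obj (colimit.cocone G),
    ⟨(IsColimit.precomposeHomEquiv e (colimit.cocone G)).symm (colimit.isColimit G)⟩,
    ⟨Iso.refl _⟩⟩

/-- The object of `𝒫𝒦` given by a small coproduct of representables. -/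
noncomputable def pcoprodObj {K : Type u₁} [Category.{v₁} K] {I : Type v₁} (B : I → K) :
    PCompletion K :=
  ⟨∐ fun i => yoneda.obj (B i), isSmallPresheaf_coprod B⟩

/-- A diagram `D` has a *multi-limit*: a set of cones through which every cone
factorizes uniquely (unique member and unique factorization). -/
def HasMultiLimit {J : Type w₁} [Category.{w₂} J] {C : Type u₁} [Category.{v₁} C]
    (D : J ⥤ C) : Prop :=
  ∃ (T : Type w) (c : T → Cone D), ∀ s : Cone D,
    ∃ p : Σ t : T, s ⟶ c t, ∀ q : Σ t : T, s ⟶ c t, q = p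

/-- `𝒦` is finitely multi-complete: every finite diagram has a multi-limit. -/
def FinitelyMultiComplete (C : Type u₁) [Category.{v₁} C] : Prop :=
  ∀ (J : Type) [SmallCategory J] [FinCategory J] (D : J ⥤ C), HasMultiLimit.{v₁} D

/-- A family `A : I → C` has a *multi-product*: a set of cones through which every cone
factorizes uniquely (unique member and unique factorization). -/
def HasMultiProduct {C : Type u₁} [Category.{v₁} C] {I : Type w₁} (A : I → C) : Prop :=
  ∃ (T : Type w) (P : T → C) (π : ∀ t i, P t ⟶ A i),
    ∀ (X : C) (f : ∀ i, X ⟶ A i),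
      ∃ p : Σ t : T, X ⟶ P t, (∀ i, p.2 ≫ π p.1 i = f i) ∧
        ∀ q : Σ t : T, X ⟶ P t, (∀ i, q.2 ≫ π q.1 i = f i) → q = p

/-- `C` has multi-products of all set-indexed families. -/
def HasMultiProducts (C : Type u₁) [Category.{v₁} C] : Prop :=
  ∀ (I : Type v₁) (A : I → C), HasMultiProduct.{v₁} A

/-- A diagram `D` has a *pre-limit*: a set of cones through which every cone
factorizes (not necessarily uniquely). -/
def HasPreLimit {J : Type w₁} [Category.{w₂} J] {C : Type u₁} [Category.{v₁} C]
    (D : J ⥤ C) : Prop :=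
  ∃ (T : Type w) (c : T → Cone D), ∀ s : Cone D, ∃ t : T, Nonempty (s ⟶ c t)

/-- `C` is pre-complete: every small diagram has a pre-limit. -/
def PreComplete (C : Type u₁) [Category.{v₁} C] : Prop :=
  ∀ (J : Type v₁) [SmallCategory J] (D : J ⥤ C), HasPreLimit.{v₁} D

/-- `C` is finitely pre-complete: every finite diagram has a pre-limit. -/
def FinitelyPreComplete (C : Type u₁) [Category.{v₁} C] : Prop :=
  ∀ (J : Type) [SmallCategory J] [FinCategory J] (D : J ⥤ C), HasPreLimit.{v₁} D

/-- A family `A : I → C` has a *pre-product*: a set of cones through which every cone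
factorizes (not necessarily uniquely). -/
def HasPreProduct {C : Type u₁} [Category.{v₁} C] {I : Type w₁} (A : I → C) : Prop :=
  ∃ (T : Type w) (P : T → C) (π : ∀ t i, P t ⟶ A i),
    ∀ (X : C) (f : ∀ i, X ⟶ A i), ∃ (t : T) (h : X ⟶ P t), ∀ i, h ≫ π t i = f i

/-- `C` (with finite products) is cartesian multi-closed: each functor `A × -` is a
left multi-adjoint. -/
def CartesianMultiClosedOf (C : Type u₁) [Category.{v₁} C] [HasFiniteProducts C] : Prop :=
  ∀ A B : C, ∃ (I : Type v₁) (E : I → C) (ev : ∀ i, A ⨯ E i ⟶ B),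
    ∀ (X : C) (c : A ⨯ X ⟶ B),
      ∃ p : Σ i : I, X ⟶ E i, (prod.map (𝟙 A) p.2 ≫ ev p.1 = c) ∧
        ∀ q : Σ i : I, X ⟶ E i, prod.map (𝟙 A) q.2 ≫ ev q.1 = c → q = p

/-- `C` is cartesian multi-closed: it has finite products and each functor `A × -` is a
left multi-adjoint. -/
def CartesianMultiClosed (C : Type u₁) [Category.{v₁} C] : Prop :=
  ∃ h : HasFiniteProducts C, @CartesianMultiClosedOf C _ h

/-- `C` is cartesian closed (as a property: it has finite products and each `A × -`
is a left adjoint). -/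
def CartesianClosedP (C : Type u₁) [Category.{v₁} C] : Prop :=
  ∃ h : CartesianMonoidalCategory C, Nonempty (@MonoidalClosed C _ h.toMonoidalCategory)

/-- `C` is locally cartesian closed: every slice category is cartesian closed. -/
def LocallyCartesianClosedP (C : Type u₁) [Category.{v₁} C] : Prop :=
  ∀ A : C, CartesianClosedP (Over A)

/-- `C` is locally cartesian multi-closed: every slice category is cartesian multi-closed. -/
def LocallyCartesianMultiClosed (C : Type u₁) [Category.{v₁} C] : Prop :=
  ∀ A : C, CartesianMultiClosed (Over A)

/-- `C` (with finite products) is cartesian pre-closed: each functor `C(A × -, B)`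
is a small presheaf. -/
def CartesianPreClosedOf (C : Type u₁) [Category.{v₁} C] [HasFiniteProducts C] : Prop :=
  ∀ A B : C, IsSmallPresheaf.{w} ((prod.functor.obj A).op ⋙ yoneda.obj B)

/-- `C` is cartesian pre-closed: it has finite products and each functor `C(A × -, B)`
is a small presheaf. -/
def CartesianPreClosed (C : Type u₁) [Category.{v₁} C] : Prop :=
  ∃ h : HasFiniteProducts C, @CartesianPreClosedOf.{w} C _ h

/-- `C` (with binary products) has weak simple products. -/
def HasWeakSimpleProductsOf (C : Type u₁) [Category.{v₁} C] [HasBinaryProducts C] : Prop :=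
  ∀ (A X B : C) (b : B ⟶ A ⨯ X),
    ∃ (P : C) (ε : A ⨯ P ⟶ B) (w : P ⟶ X),
      ε ≫ b = prod.map (𝟙 A) w ∧
      ∀ (P' : C) (ε' : A ⨯ P' ⟶ B) (w' : P' ⟶ X), ε' ≫ b = prod.map (𝟙 A) w' →
        ∃ f : P' ⟶ P, ε' = prod.map (𝟙 A) f ≫ ε ∧ w' = f ≫ w

/-- `C` has binary products and weak simple products. -/
def HasWeakSimpleProducts (C : Type u₁) [Category.{v₁} C] : Prop :=
  ∃ h : HasBinaryProducts C, @HasWeakSimpleProductsOf C _ h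

/-- `C` has a subobject classifier: a mono `ε : 1 ⟶ Ω` from the terminal object such that
every monomorphism is a pullback of `ε` along a unique morphism. -/
def HasSubobjectClassifierP (C : Type u₁) [Category.{v₁} C] : Prop :=
  ∃ (T Ω : C) (hT : IsTerminal T) (ε : T ⟶ Ω), Mono ε ∧
    ∀ ⦃U X : C⦄ (m : U ⟶ X), Mono m → ∃! χ : X ⟶ Ω, IsPullback (hT.from U) m ε χ

/-- `C` is an elementary topos: finitely complete, cartesian closed,
with a subobject classifier. -/
def IsElementaryTopos (C : Type u₁) [Category.{v₁} C] : Prop :=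
  HasFiniteLimits C ∧ CartesianClosedP C ∧ HasSubobjectClassifierP C

/-- `C` is a multi-topos: finitely complete, cartesian multi-closed,
with a subobject classifier. -/
def IsMultiTopos (C : Type u₁) [Category.{v₁} C] : Prop :=
  HasFiniteLimits C ∧ CartesianMultiClosed C ∧ HasSubobjectClassifierP C

/-- A coproduct cocone is *universal*: it is stable under pullback. -/
def CofanUniversal {C : Type u₁} [Category.{v₁} C] {I : Type w₁} {X : I → C}
    (c : Cofan X) : Prop :=
  ∀ {W : C} (h : W ⟶ c.pt) (Y : I → C) (p : ∀ i, Y i ⟶ W) (q : ∀ i, Y i ⟶ X i),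
    (∀ i, IsPullback (p i) (q i) h (c.inj i)) → Nonempty (IsColimit (Cofan.mk W p))

/-- A coproduct cocone is *disjoint*: injections are monic with initial pairwise
intersections. -/
def CofanDisjoint {C : Type u₁} [Category.{v₁} C] {I : Type w₁} {X : I → C}
    (c : Cofan X) : Prop :=
  (∀ i, Mono (c.inj i)) ∧
    ∀ i j, i ≠ j → ∀ {Z : C} (u : Z ⟶ X i) (v : Z ⟶ X j),
      IsPullback u v (c.inj i) (c.inj j) → Nonempty (IsInitial Z)

/-- `C` is extensive: finitely complete, with finite coproducts which are
universal and disjoint. -/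
def IsExtensive (C : Type u₁) [Category.{v₁} C] : Prop :=
  HasFiniteLimits C ∧ HasFiniteCoproducts C ∧
    ∀ (I : Type) [Finite I] (X : I → C) (c : Cofan X),
      Nonempty (IsColimit c) → CofanUniversal c ∧ CofanDisjoint c

/-- `C` is infinitary extensive: finitely complete, with small (`Type w`-indexed)
coproducts which are universal and disjoint. -/
def IsInfinitaryExtensive (C : Type u₁) [Category.{v₁} C] : Prop :=
  HasFiniteLimits C ∧ HasCoproducts.{w} C ∧
    ∀ (I : Type w) (X : I → C) (c : Cofan X),
      Nonempty (IsColimit c) → CofanUniversal c ∧ CofanDisjoint c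

/-- A parallel pair `r₁ r₂ : R ⟶ X` is an (internal) equivalence relation. -/
structure IsEquivalenceRelationPair {C : Type u₁} [Category.{v₁} C] {R X : C}
    (r₁ r₂ : R ⟶ X) : Prop where
  jointlyMono : ∀ {Z : C} (a b : Z ⟶ R), a ≫ r₁ = b ≫ r₁ → a ≫ r₂ = b ≫ r₂ → a = b
  refl : ∀ {Z : C} (f : Z ⟶ X), ∃ d : Z ⟶ R, d ≫ r₁ = f ∧ d ≫ r₂ = f
  symm : ∃ s : R ⟶ R, s ≫ r₁ = r₂ ∧ s ≫ r₂ = r₁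
  trans : ∀ {Z : C} (a b : Z ⟶ R), a ≫ r₂ = b ≫ r₁ →
    ∃ t : Z ⟶ R, t ≫ r₁ = a ≫ r₁ ∧ t ≫ r₂ = b ≫ r₂

/-- `C` is a regular category: finitely complete, with (regular epi, mono)
factorizations, and regular epimorphisms are stable under pullback. -/
def IsRegularCat (C : Type u₁) [Category.{v₁} C] : Prop :=
  HasFiniteLimits C ∧
    (∀ {X Y : C} (f : X ⟶ Y), ∃ (Z : C) (e : X ⟶ Z) (m : Z ⟶ Y),
      e ≫ m = f ∧ Nonempty (RegularEpi e) ∧ Mono m) ∧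
    (∀ {P X Y Z : C} (fst : P ⟶ X) (snd : P ⟶ Y) (f : X ⟶ Z) (g : Y ⟶ Z),
      IsPullback fst snd f g → Nonempty (RegularEpi g) → Nonempty (RegularEpi fst))

/-- `C` is an exact (Barr-exact) category: regular with effective equivalence relations. -/
def IsExactCat (C : Type u₁) [Category.{v₁} C] : Prop :=
  IsRegularCat C ∧
    ∀ {R X : C} (r₁ r₂ : R ⟶ X), IsEquivalenceRelationPair r₁ r₂ →
      ∃ (Y : C) (f : X ⟶ Y), IsPullback r₁ r₂ f f

/-- A pretopos is an exact and extensive category. -/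
def IsPretopos (C : Type u₁) [Category.{v₁} C] : Prop :=
  IsExactCat C ∧ IsExtensive C

/-- `C` is additive: preadditive with finite biproducts. -/
def IsAdditive (C : Type u₁) [Category.{v₁} C] : Prop :=
  ∃ p : Preadditive C, letI := p; HasFiniteBiproducts C

/-- `C` is wellpowered: every object has only a set of subobjects. -/
def Wellpowered (C : Type u₁) [Category.{v₁} C] : Prop :=
  ∀ X : C, Small.{w} (Subobject X)

/-- `C` is cowellpowered: every object has only a set of quotient objects. -/
def Cowellpowered (C : Type u₁) [Category.{v₁} C] : Prop :=
  ∀ X : C, Small.{w} (Subobject (Opposite.op X))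

/-- `C` has a clique-like class of objects, indexed by all ordinals. -/
def HasCliqueLikeClass (C : Type u₁) [Category.{v₁} C] : Prop :=
  ∃ (A : Ordinal.{v₁} → C) (R : MorphismProperty C),
    (∀ {X Y Z : C} (v : X ⟶ Y) (u : Y ⟶ Z), R (v ≫ u) → R u) ∧
    (∀ k, ∃ f g : A 0 ⟶ A k, f ≠ g ∧ R f ∧ R g) ∧
    ((∀ i k : Ordinal.{v₁}, 0 < i → i < k → ∀ f : A k ⟶ A i, ¬ R f) ∨
     (∀ k i : Ordinal.{v₁}, 0 < k → k < i → ∀ f : A k ⟶ A i, ¬ R f))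

/-- A presheaf is petty: a quotient of a small coproduct of representables. -/
def IsPetty {C : Type u₁} [Category.{v₁} C] (F : Cᵒᵖ ⥤ Type v₁) : Prop :=
  ∃ (I : Type v₁) (A : I → C) (e : (∐ fun i => yoneda.obj (A i)) ⟶ F), Epi e

/-- A presheaf is lucid: petty, and equalizers of pairs of morphisms from petty
presheaves into it are petty. -/
noncomputable def IsLucid {C : Type u₁} [Category.{v₁} C] (F : Cᵒᵖ ⥤ Type v₁) : Prop :=
  IsPetty F ∧ ∀ (P : Cᵒᵖ ⥤ Type v₁), IsPetty P → ∀ u₁ u₂ : P ⟶ F, IsPetty (equalizer u₁ u₂)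

universe v u

section Helpers

open Opposite

variable {K : Type u} [Category.{v} K]

/-- A family of maps of presheaves is pointwise a coproduct cocone. -/
def Pw {I : Type w} {X : I → (Kᵒᵖ ⥤ Type v)} {Z : Kᵒᵖ ⥤ Type v} (p : ∀ i, X i ⟶ Z) : Prop :=
  ∀ A : Kᵒᵖ, Function.Bijective (fun q : Σ i, (X i).obj A => (p q.1).app A q.2)

theorem Pw.inj_hom {I : Type w} {B : I → K} {Z : Kᵒᵖ ⥤ Type v}
    {p : ∀ i, yoneda.obj (B i) ⟶ Z} (hp : Pw p) {X : K} {i j : I} {f : X ⟶ B i} {g : X ⟶ B j}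
    (h : yoneda.map f ≫ p i = yoneda.map g ≫ p j) :
    (⟨i, f⟩ : Σ i, X ⟶ B i) = ⟨j, g⟩ := by
  have := congrArg yonedaEquiv h
  simp only [yonedaEquiv_comp, yonedaEquiv_yoneda_map] at this
  exact @(hp (op X)).1 ⟨i, f⟩ ⟨j, g⟩ this

theorem Pw.inj_hom' {I : Type w} {B : I → K} {Z : Kᵒᵖ ⥤ Type v}
    {p : ∀ i, yoneda.obj (B i) ⟶ Z} (hp : Pw p) {X : K} {i : I} {f g : X ⟶ B i}
    (h : yoneda.map f ≫ p i = yoneda.map g ≫ p i) : f = g := by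
  have := hp.inj_hom h
  simpa using this

theorem Pw.surj_hom {I : Type w} {B : I → K} {Z : Kᵒᵖ ⥤ Type v}
    {p : ∀ i, yoneda.obj (B i) ⟶ Z} (hp : Pw p) {X : K} (z : yoneda.obj X ⟶ Z) :
    ∃ (i : I) (f : X ⟶ B i), yoneda.map f ≫ p i = z := by
  obtain ⟨⟨i, f⟩, h⟩ := (hp (op X)).2 (yonedaEquiv z)
  refine ⟨i, f, yonedaEquiv.injective ?_⟩
  rw [yonedaEquiv_comp, yonedaEquiv_yoneda_map]
  exact h

theorem pw_of_hom {I : Type w} {B : I → K} {Z : Kᵒᵖ ⥤ Type v}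
    (p : ∀ i, yoneda.obj (B i) ⟶ Z)
    (h₁ : ∀ (X : K) (i j : I) (f : X ⟶ B i) (g : X ⟶ B j),
      yoneda.map f ≫ p i = yoneda.map g ≫ p j → (⟨i, f⟩ : Σ i, X ⟶ B i) = ⟨j, g⟩)
    (h₂ : ∀ (X : K) (z : yoneda.obj X ⟶ Z), ∃ (i : I) (f : X ⟶ B i),
      yoneda.map f ≫ p i = z) : Pw p := by
  rintro ⟨X⟩
  constructor
  · rintro ⟨i, f⟩ ⟨j, g⟩ h
    refine h₁ X i j f g (yonedaEquiv.injective ?_)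
    rw [yonedaEquiv_comp, yonedaEquiv_yoneda_map, yonedaEquiv_comp, yonedaEquiv_yoneda_map]
    exact h
  · intro z
    obtain ⟨i, f, h⟩ := h₂ X (yonedaEquiv.symm z)
    refine ⟨⟨i, f⟩, ?_⟩
    have := congrArg yonedaEquiv h
    rw [yonedaEquiv_comp, yonedaEquiv_yoneda_map, Equiv.apply_symm_apply] at this
    exact this

theorem Pw.existsUnique_desc {I : Type w} {X : I → (Kᵒᵖ ⥤ Type v)} {Z : Kᵒᵖ ⥤ Type v}
    {p : ∀ i, X i ⟶ Z} (hp : Pw p) {T : Kᵒᵖ ⥤ Type v} (f : ∀ i, X i ⟶ T) :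
    ∃! g : Z ⟶ T, ∀ i, p i ≫ g = f i := by
  let e := fun A => Equiv.ofBijective _ (hp A)
  have he : ∀ A i x, (e A).symm ((p i).app A x) = ⟨i, x⟩ := fun A i x =>
    (e A).symm_apply_apply ⟨i, x⟩
  let G : ∀ A, (Σ i, (X i).obj A) → T.obj A := fun A q => (f q.1).app A q.2
  have hG : ∀ A i x, G A ((e A).symm ((p i).app A x)) = (f i).app A x := fun A i x =>
    congrArg (G A) (he A i x)
  refine ⟨{ app := fun A => TypeCat.ofHom fun z => G A ((e A).symm z)
            naturality := ?_ }, ?_, ?_⟩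
  · intro A B u
    ext z
    obtain ⟨⟨i, x⟩, rfl⟩ := (hp A).2 z
    have h1 : Z.map u ((p i).app A x) = (p i).app B ((X i).map u x) :=
      (NatTrans.naturality_apply (p i) u x).symm
    have h2 : (f i).app B ((X i).map u x) = T.map u ((f i).app A x) :=
      NatTrans.naturality_apply (f i) u x
    change G B ((e B).symm (Z.map u ((p i).app A x))) =
      T.map u (G A ((e A).symm ((p i).app A x)))
    rw [h1, hG, hG, h2]
  · intro i
    ext A x
    exact hG A i x
  · intro g hg
    ext A z
    obtain ⟨⟨i, x⟩, rfl⟩ := (hp A).2 z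
    have := congrArg (fun (k : X i ⟶ T) => k.app A x) (hg i)
    exact this.trans (hG A i x).symm

/-- The pointwise coproduct of presheaves. -/
def sigmaP {I : Type v} (X : I → (Kᵒᵖ ⥤ Type v)) : Kᵒᵖ ⥤ Type v where
  obj A := Σ i, (X i).obj A
  map u := TypeCat.ofHom fun q => ⟨q.1, (X q.1).map u q.2⟩

/-- Injections of the pointwise coproduct. -/
def sigmaPι {I : Type v} (X : I → (Kᵒᵖ ⥤ Type v)) (i : I) : X i ⟶ sigmaP X where
  app A := TypeCat.ofHom fun x => ⟨i, x⟩
  naturality A B u := by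
    ext x
    rfl

theorem sigmaP_pw {I : Type v} (X : I → (Kᵒᵖ ⥤ Type v)) : Pw (sigmaPι X) := by
  intro A
  exact Function.bijective_id

theorem Pw.comp_iso {I : Type w} {X : I → (Kᵒᵖ ⥤ Type v)} {Z Z' : Kᵒᵖ ⥤ Type v}
    {p : ∀ i, X i ⟶ Z} (hp : Pw p) (e : Z ≅ Z') {p' : ∀ i, X i ⟶ Z'}
    (h : ∀ i, p i ≫ e.hom = p' i) : Pw p' := by
  intro A
  have : (fun q : Σ i, (X i).obj A => (p' q.1).app A q.2) =
      (e.app A).toEquiv ∘ (fun q : Σ i, (X i).obj A => (p q.1).app A q.2) := by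
    funext q
    simp [← h]
  rw [this]
  exact (e.app A).toEquiv.bijective.comp (hp A)

theorem Pw.isColimit {I : Type w} {X : I → (Kᵒᵖ ⥤ Type v)} {Z : Kᵒᵖ ⥤ Type v}
    {p : ∀ i, X i ⟶ Z} (hp : Pw p) : Nonempty (IsColimit (Cofan.mk Z p)) := by
  choose d hd hu using fun (T : Kᵒᵖ ⥤ Type v) (f : ∀ i, X i ⟶ T) => hp.existsUnique_desc f
  exact ⟨Cofan.IsColimit.mk _ (fun t => d t.pt t.inj) (fun t j => hd t.pt t.inj j)
    (fun t m h => hu t.pt t.inj m h)⟩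

theorem isCoprod_iff (F : Kᵒᵖ ⥤ Type v) : IsCoproductOfRepresentables F ↔
    ∃ (I : Type v) (A : I → K) (p : ∀ i, yoneda.obj (A i) ⟶ F), Pw p := by
  constructor
  · rintro ⟨I, A, ⟨e⟩⟩
    obtain ⟨h⟩ := (sigmaP_pw (fun i => yoneda.obj (A i))).isColimit
    exact ⟨I, A, _, (sigmaP_pw (fun i => yoneda.obj (A i))).comp_iso
      (h.coconePointUniqueUpToIso (colimit.isColimit _) ≪≫ e.symm) (fun i => rfl)⟩
  · rintro ⟨I, A, p, hp⟩
    obtain ⟨h⟩ := hp.isColimit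
    exact ⟨I, A, ⟨h.coconePointUniqueUpToIso (colimit.isColimit _)⟩⟩

theorem sigmaP_isCoprod {I : Type v} (X : I → (Kᵒᵖ ⥤ Type v))
    (hX : ∀ i, IsCoproductOfRepresentables (X i)) : IsCoproductOfRepresentables (sigmaP X) := by
  choose J A p hp using fun i => (isCoprod_iff (X i)).1 (hX i)
  refine (isCoprod_iff _).2 ⟨Σ i, J i, fun k => A k.1 k.2,
    fun k => p k.1 k.2 ≫ sigmaPι X k.1, ?_⟩
  intro B
  constructor
  · rintro ⟨⟨i, j⟩, f⟩ ⟨⟨i', j'⟩, f'⟩ h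
    have h' : (⟨i, (p i j).app B f⟩ : Σ i, (X i).obj B) = ⟨i', (p i' j').app B f'⟩ := h
    obtain ⟨rfl, h2⟩ := Sigma.mk.inj_iff.1 h'
    have := @(hp i B).1 ⟨j, f⟩ ⟨j', f'⟩ (eq_of_heq h2)
    obtain ⟨rfl, h3⟩ := Sigma.mk.inj_iff.1 this
    obtain rfl := eq_of_heq h3
    rfl
  · rintro ⟨i, x⟩
    obtain ⟨⟨j, f⟩, rfl⟩ := (hp i B).2 x
    exact ⟨⟨⟨i, j⟩, f⟩, rfl⟩

/-! ### Coproducts in the completion -/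

/-- Pointwise coproduct cofans in the completion. -/
def CPw {I : Type w} {X : I → SigmaCompletion K} (c : Cofan X) : Prop :=
  Pw (fun i => (c.inj i).hom)

theorem CPw.isColimit {I : Type w} {X : I → SigmaCompletion K} {c : Cofan X} (hc : CPw c) :
    Nonempty (IsColimit c) := by
  choose d hd hu using fun (T : Kᵒᵖ ⥤ Type v) (f : ∀ i, (X i).obj ⟶ T) =>
    Pw.existsUnique_desc hc f
  refine ⟨Cofan.IsColimit.mk _
    (fun t => ObjectProperty.homMk (d t.pt.obj (fun i => (t.inj i).hom))) ?_ ?_⟩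
  · intro t j
    apply ObjectProperty.hom_ext
    exact hd t.pt.obj (fun i => (t.inj i).hom) j
  · intro t m h
    apply ObjectProperty.hom_ext
    exact hu t.pt.obj (fun i => (t.inj i).hom) m.hom
      (fun i => congrArg InducedCategory.Hom.hom (h i))

/-- The canonical coproduct in the completion. -/
def sigmaCofan {I : Type v} (X : I → SigmaCompletion K) : Cofan X :=
  Cofan.mk (⟨sigmaP (fun i => (X i).obj), sigmaP_isCoprod _ (fun i => (X i).property)⟩ :
    SigmaCompletion K) (fun i => ObjectProperty.homMk (sigmaPι (fun i => (X i).obj) i))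

theorem sigmaCofan_cpw {I : Type v} (X : I → SigmaCompletion K) : CPw (sigmaCofan X) :=
  sigmaP_pw (fun i => (X i).obj)

theorem cpw_of_isColimit {I : Type v} {X : I → SigmaCompletion K} {c : Cofan X}
    (hc : IsColimit c) : CPw c := by
  obtain ⟨h⟩ := (sigmaCofan_cpw X).isColimit
  let e := h.coconePointUniqueUpToIso hc
  refine (sigmaP_pw (fun i => (X i).obj)).comp_iso
    ((ObjectProperty.ι (IsCoproductOfRepresentables (C := K))).mapIso e) ?_
  intro i
  have : (sigmaCofan X).inj i ≫ e.hom = c.inj i := h.comp_coconePointUniqueUpToIso_hom hc ⟨i⟩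
  exact congrArg InducedCategory.Hom.hom this

theorem cpw_of_isColimit_zero {I : Type} {X : I → SigmaCompletion K} {c : Cofan X}
    (hc : IsColimit c) : CPw c := by
  let c' : Cofan (fun i : ULift.{v} I => X i.down) := Cofan.mk c.pt (fun i => c.inj i.down)
  have hc' : IsColimit c' := Cofan.IsColimit.mk _
    (fun t => Cofan.IsColimit.desc hc (fun i => t.inj ⟨i⟩))
    (fun t j => Cofan.IsColimit.fac hc (fun i => t.inj ⟨i⟩) j.down)
    (fun t m h => Cofan.IsColimit.hom_ext hc _ _ (fun i => by
      rw [Cofan.IsColimit.fac]; exact h ⟨i⟩))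
  have h := cpw_of_isColimit hc'
  intro A
  constructor
  · rintro ⟨i, x⟩ ⟨j, y⟩ hxy
    have := @(h A).1 ⟨⟨i⟩, x⟩ ⟨⟨j⟩, y⟩ hxy
    obtain ⟨h1, h2⟩ := Sigma.mk.inj_iff.1 this
    obtain rfl : i = j := congrArg ULift.down h1
    obtain rfl := eq_of_heq h2
    rfl
  · intro z
    obtain ⟨⟨⟨i⟩, x⟩, hx⟩ := (h A).2 z
    exact ⟨⟨i, x⟩, hx⟩

/-- Representables in the completion. -/
def yS : K ⥤ SigmaCompletion K :=
  ObjectProperty.lift _ yoneda (fun X => (isCoprod_iff _).2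
    ⟨PUnit, fun _ => X, fun _ => 𝟙 _, by
      intro A
      constructor
      · rintro ⟨⟨⟩, f⟩ ⟨⟨⟩, g⟩ h
        obtain rfl : f = g := h
        rfl
      · intro z
        exact ⟨⟨⟨⟩, z⟩, rfl⟩⟩)

instance : (yS (K := K)).Full := by unfold yS; infer_instance
instance : (yS (K := K)).Faithful := by unfold yS; infer_instance

/-- Elements as morphisms. -/
def elt {W : SigmaCompletion K} {A : K} (w : W.obj.obj (op A)) : yS.obj A ⟶ W :=
  ObjectProperty.homMk (yonedaEquiv.symm w)

theorem elt_comp {W Z : SigmaCompletion K} {A : K} (w : W.obj.obj (op A)) (f : W ⟶ Z) :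
    elt w ≫ f = elt (f.hom.app (op A) w) := by
  apply ObjectProperty.hom_ext
  exact yonedaEquiv_symm_naturality_right _ _ _

theorem elt_inj {W : SigmaCompletion K} {A : K} {w w' : W.obj.obj (op A)}
    (h : elt w = elt w') : w = w' :=
  yonedaEquiv.symm.injective (congrArg InducedCategory.Hom.hom h)

theorem elt_surj {W : SigmaCompletion K} {A : K} (f : yS.obj A ⟶ W) :
    ∃ w : W.obj.obj (op A), elt w = f :=
  ⟨yonedaEquiv f.hom, ObjectProperty.hom_ext _ (yonedaEquiv.symm_apply_apply f.hom)⟩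

theorem CPw.universal {I : Type w} {X : I → SigmaCompletion K} {c : Cofan X} (hc : CPw c) :
    CofanUniversal c := by
  intro W h Y p q hpb
  refine CPw.isColimit ?_
  rintro ⟨A⟩
  constructor
  · rintro ⟨i, y⟩ ⟨j, y'⟩ hy
    replace hy : (p i).hom.app (op A) y = (p j).hom.app (op A) y' := hy
    have key : ∀ i (y : (Y i).obj.obj (op A)), (c.inj i).hom.app (op A) ((q i).hom.app (op A) y)
        = h.hom.app (op A) ((p i).hom.app (op A) y) := by
      intro i y
      have := congrArg (fun k => elt y ≫ k) (hpb i).w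
      simp only [← Category.assoc, elt_comp] at this
      exact (elt_inj this).symm
    have h1 := @(hc (op A)).1 ⟨i, (q i).hom.app (op A) y⟩ ⟨j, (q j).hom.app (op A) y'⟩
      ((key i y).trans ((congrArg _ hy).trans (key j y').symm))
    obtain ⟨rfl, h2⟩ := Sigma.mk.inj_iff.1 h1
    have : elt y = elt y' := (hpb i).hom_ext (by rw [elt_comp, elt_comp, hy])
      (by rw [elt_comp, elt_comp, eq_of_heq h2])
    rw [elt_inj this]
  · intro z
    obtain ⟨⟨i, x⟩, hx⟩ := (hc (op A)).2 (h.hom.app (op A) z)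
    have e : elt z ≫ h = elt x ≫ c.inj i := by
      rw [elt_comp, elt_comp]
      exact congrArg elt hx.symm
    obtain ⟨y, hy⟩ := elt_surj ((hpb i).lift _ _ e)
    refine ⟨⟨i, y⟩, ?_⟩
    have := (hpb i).lift_fst _ _ e
    rw [← hy, elt_comp] at this
    exact elt_inj this

theorem CPw.disjoint {I : Type w} {X : I → SigmaCompletion K} {c : Cofan X} (hc : CPw c) :
    CofanDisjoint c := by
  constructor
  · intro i
    constructor
    intro Z f g hfg
    apply ObjectProperty.hom_ext
    ext A z
    have h0 := congrArg (fun k : Z ⟶ c.pt => k.hom.app A z) hfg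
    have h1 := @(hc A).1 ⟨i, f.hom.app A z⟩ ⟨i, g.hom.app A z⟩ h0
    exact eq_of_heq (Sigma.mk.inj_iff.1 h1).2
  · intro i j hij Z a b hpb
    have hem : ∀ A, IsEmpty (Z.obj.obj A) := by
      intro A
      constructor
      intro z
      have h0 := congrArg (fun k : Z ⟶ c.pt => k.hom.app A z) hpb.w
      have h1 := @(hc A).1 ⟨i, a.hom.app A z⟩ ⟨j, b.hom.app A z⟩ h0
      exact hij (Sigma.mk.inj_iff.1 h1).1
    refine ⟨IsInitial.ofUniqueHom (fun T => ObjectProperty.homMk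
      { app := fun A => TypeCat.ofHom fun z => (hem A).elim z
        naturality := ?_ }) ?_⟩
    · intro A B f
      ext z
      exact (hem A).elim z
    · intro T m
      apply ObjectProperty.hom_ext
      ext A z
      exact (hem A).elim z

/-! ### Limits -/

theorem multi_of_lim [HasFiniteLimits (SigmaCompletion K)] : FinitelyMultiComplete K := by
  intro J _ _ D
  let L := limit (D ⋙ yS)
  obtain ⟨T, A, a, ha⟩ := (isCoprod_iff L.obj).1 L.property
  let a' : ∀ t, yS.obj (A t) ⟶ L := fun t => ObjectProperty.homMk (a t)
  have hπ : ∀ t j, ∃ f : A t ⟶ D.obj j, yS.map f = a' t ≫ limit.π (D ⋙ yS) j := by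
    intro t j
    exact (yS (K := K)).map_surjective _
  choose f hf using hπ
  refine ⟨T, fun t => { pt := A t, π := { app := fun j => f t j, naturality := ?_ } }, ?_⟩
  · intro j k g
    apply (yS (K := K)).map_injective
    have := limit.w (D ⋙ yS) g
    simp only [Functor.const_obj_obj, Functor.const_obj_map, Category.id_comp, Functor.map_comp, hf]
    rw [Category.assoc, ← this]
    rfl
  · intro s
    let l : yS.obj s.pt ⟶ L := limit.lift (D ⋙ yS) (yS.mapCone s)
    obtain ⟨t, g, hg⟩ := ha.surj_hom (X := s.pt) l.hom
    have hg' : yS.map g ≫ a' t = l := ObjectProperty.hom_ext _ hg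
    refine ⟨⟨t, { hom := g, w := ?_ }⟩, ?_⟩
    · intro j
      apply (yS (K := K)).map_injective
      simp only [Functor.map_comp, hf]
      rw [← Category.assoc, hg']
      exact limit.lift_π _ _
    · rintro ⟨t', m⟩
      have hm : yS.map m.hom ≫ a' t' = l := by
        apply limit.hom_ext
        intro j
        rw [Category.assoc, ← hf, ← Functor.map_comp]
        refine Eq.trans ?_ (limit.lift_π (yS.mapCone s) j).symm
        exact congrArg yS.map (m.w j)
      have := ha.inj_hom (X := s.pt) (f := m.hom) (g := g) (i := t') (j := t)
        ((congrArg InducedCategory.Hom.hom hm).trans hg.symm)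
      obtain ⟨rfl, h2⟩ := Sigma.mk.inj_iff.1 this
      congr 1
      exact ConeMorphism.ext _ _ (eq_of_heq h2)

theorem closed_of_multi (hK : FinitelyMultiComplete K) (J : Type) [SmallCategory J] [FinCategory J]
    (D : J ⥤ (Kᵒᵖ ⥤ Type v)) (hD : ∀ j, IsCoproductOfRepresentables (D.obj j))
    (c : Cone D) (hc : IsLimit c) : IsCoproductOfRepresentables c.pt := by
  choose I A p hp using fun j => (isCoprod_iff (D.obj j)).1 (hD j)
  let S := { i : ∀ j, I j // ∀ ⦃j k : J⦄ (g : j ⟶ k), ∃ f : A j (i j) ⟶ A k (i k),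
    yoneda.map f ≫ p k (i k) = p j (i j) ≫ D.map g }
  choose m hm using fun (i : S) => i.2
  let E : S → (J ⥤ K) := fun i =>
    { obj := fun j => A j (i.1 j)
      map := fun g => m i g
      map_id := fun j => (hp j).inj_hom' (by rw [hm]; simp)
      map_comp := fun {j k l} g h => (hp l).inj_hom' (by
        rw [hm, Functor.map_comp, Functor.map_comp, Category.assoc, hm i h,
          reassoc_of% (hm i g)]) }
  choose T d hd using fun i => hK J (E i)
  let q' : ∀ (i : S) (s : Cone (E i)), Cone D := fun i s =>
    { pt := yoneda.obj s.pt
      π := { app := fun j => yoneda.map (s.π.app j) ≫ p j (i.1 j)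
             naturality := fun j k g => by
              have h1 : s.π.app j ≫ m i g = s.π.app k := s.w g
              simp only [Functor.const_obj_obj, Functor.const_obj_map, Category.id_comp,
                Category.assoc]
              rw [← hm, ← h1, Functor.map_comp, Category.assoc] } }
  have hq' : ∀ i s j, hc.lift (q' i s) ≫ c.π.app j = yoneda.map (s.π.app j) ≫ p j (i.1 j) :=
    fun i s j => hc.fac _ _
  refine (isCoprod_iff _).2 ⟨Σ i : S, T i, fun k => (d k.1 k.2).pt,
    fun k => hc.lift (q' k.1 (d k.1 k.2)), ?_⟩
  apply pw_of_hom
  · rintro X ⟨i, t⟩ ⟨i', t'⟩ f f' h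
    have h1 : ∀ j, (⟨i.1 j, f ≫ (d i t).π.app j⟩ : Σ a, X ⟶ A j a) =
        ⟨i'.1 j, f' ≫ (d i' t').π.app j⟩ := by
      intro j
      apply (hp j).inj_hom
      have := congrArg (fun k => k ≫ c.π.app j) h
      simp only [Category.assoc, hq'] at this
      simpa only [Functor.map_comp, Category.assoc] using this
    obtain rfl : i = i' := Subtype.ext (funext fun j => (Sigma.mk.inj_iff.1 (h1 j)).1)
    have h2 : ∀ j, f ≫ (d i t).π.app j = f' ≫ (d i t').π.app j := fun j =>
      eq_of_heq (Sigma.mk.inj_iff.1 (h1 j)).2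
    let s : Cone (E i) := (d i t).extend f
    obtain ⟨z, hz⟩ := hd i s
    have e := (hz ⟨t, { hom := f, w := fun j => rfl }⟩).trans
      (hz ⟨t', { hom := f', w := fun j => (h2 j).symm }⟩).symm
    obtain ⟨rfl, e2⟩ := Sigma.mk.inj_iff.1 e
    obtain rfl : f = f' := congrArg ConeMorphism.hom (eq_of_heq e2)
    rfl
  · intro X z
    choose i f hf using fun j => (hp j).surj_hom (z ≫ c.π.app j)
    have hi : ∀ ⦃j k : J⦄ (g : j ⟶ k), ∃ f : A j (i j) ⟶ A k (i k),
        yoneda.map f ≫ p k (i k) = p j (i j) ≫ D.map g := by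
      intro j k g
      obtain ⟨a, r, hr⟩ := (hp k).surj_hom (p j (i j) ≫ D.map g)
      have : (⟨a, f j ≫ r⟩ : Σ a, X ⟶ A k a) = ⟨i k, f k⟩ := by
        apply (hp k).inj_hom
        rw [Functor.map_comp, Category.assoc, hr, reassoc_of% (hf j), hf, c.w]
      obtain ⟨rfl, -⟩ := Sigma.mk.inj_iff.1 this
      exact ⟨r, hr⟩
    let i' : S := ⟨i, hi⟩
    let s : Cone (E i') :=
      { pt := X
        π := { app := fun j => f j
               naturality := fun j k g => by
                apply (hp k).inj_hom'
                have h1 : yoneda.map ((E i').map g) ≫ p k (i k) = p j (i j) ≫ D.map g := hm i' g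
                simp only [Functor.const_obj_obj, Functor.const_obj_map, Category.id_comp]
                rw [Functor.map_comp, Category.assoc, hf]
                erw [h1]
                rw [reassoc_of% (hf j), c.w] } }
    obtain ⟨⟨t, r⟩, -⟩ := hd i' s
    refine ⟨⟨i', t⟩, r.hom, ?_⟩
    apply hc.hom_ext
    intro j
    rw [Category.assoc, hq', ← Category.assoc, ← Functor.map_comp, r.w, ← hf]

theorem lim_of_multi (hK : FinitelyMultiComplete K) : HasFiniteLimits (SigmaCompletion K) := by
  constructor
  intro J _ _
  have : ObjectProperty.IsClosedUnderLimitsOfShape (IsCoproductOfRepresentables (C := K)) J := by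
    constructor
    rintro F ⟨P⟩
    exact closed_of_multi hK J P.diag P.prop_diag_obj _ P.isLimit
  infer_instance

theorem hasCoproducts_sigma : HasCoproducts.{v} (SigmaCompletion K) := by
  exact hasCoproducts_of_colimit_cofans (fun {_} f => sigmaCofan f)
    (fun {_} f => (sigmaCofan_cpw f).isColimit.some)

end Helpers

/-- Proposition 2.4: For every category `𝒦` the following are equivalent:
(i) `Σ𝒦` is extensive; (ii) `Σ𝒦` is infinitary extensive; (iii) `𝒦` is finitely
multi-complete. -/
theorem sigmaCompletion_extensive_tfae (K : Type u) [Category.{v} K] :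
    [IsExtensive (SigmaCompletion K),
     IsInfinitaryExtensive.{v} (SigmaCompletion K),
     FinitelyMultiComplete K].TFAE := by
  tfae_have 1 → 3 := fun h => by
    have := h.1
    exact multi_of_lim
  tfae_have 3 → 2 := fun h => ⟨lim_of_multi h, hasCoproducts_sigma, fun I X c ⟨hc⟩ =>
    ⟨(cpw_of_isColimit hc).universal, (cpw_of_isColimit hc).disjoint⟩⟩
  tfae_have 2 → 1 := fun h => ⟨h.1, by
    have := h.2.1
    exact hasFiniteCoproducts_of_hasCoproducts.{v} _, fun I _ X c ⟨hc⟩ =>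
    ⟨(cpw_of_isColimit_zero hc).universal, (cpw_of_isColimit_zero hc).disjoint⟩⟩
  tfae_finish
end FreeCompletions
end

section
/- Let (A_{ij})_{j∈J}, for i ∈ I, be a family of objects of the free coproduct completion Σ𝒦 of a category 𝒦 (all indexed by the same set J). Then a product of this family exists in Σ𝒦 if and only if for every function φ : I → J a multi-product of the family (A_{iφ(i)})_{i∈I} exists in 𝒦. -/
/- Common definitions for formalizing "How nice are free completions of categories?"
   by Adámek and Rosický. -/

open CategoryTheory CategoryTheory.Limits

universe w w₁ w₂ v₁ u₁

namespace FreeCompletions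

universe v u

/-- The explicit presheaf `X ↦ Σ i, (X ⟶ B i)`. -/
def sigmaPsh {K : Type u} [Category.{v} K] {T : Type v} (B : T → K) : Kᵒᵖ ⥤ Type v where
  obj X := Σ t : T, X.unop ⟶ B t
  map g := TypeCat.ofHom fun p => ⟨p.1, g.unop ≫ p.2⟩

/-- An element of the explicit presheaf. -/
def sigmaElt {K : Type u} [Category.{v} K] {T : Type v} (B : T → K) {X : K}
    (p : Σ t : T, X ⟶ B t) : (sigmaPsh B).obj (Opposite.op X) := p

/-- Comparison from the coproduct to the explicit presheaf. -/
noncomputable def toSigmaPsh {K : Type u} [Category.{v} K] {T : Type v} (B : T → K) :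
    (∐ fun t => yoneda.obj (B t)) ⟶ sigmaPsh B :=
  Limits.Sigma.desc fun t => (yonedaEquiv (X := B t) (F := sigmaPsh B)).symm (sigmaElt B ⟨t, 𝟙 (B t)⟩)

/-- Comparison from the explicit presheaf to the coproduct. -/
noncomputable def ofSigmaPsh {K : Type u} [Category.{v} K] {T : Type v} (B : T → K) :
    sigmaPsh B ⟶ (∐ fun t => yoneda.obj (B t)) where
  app X := TypeCat.ofHom fun (p : Σ t : T, X.unop ⟶ B t) =>
    yonedaEquiv (yoneda.map p.2 ≫ Sigma.ι (fun t => yoneda.obj (B t)) p.1)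
  naturality X Y g := by
    ext p
    refine Eq.trans ?_ (yonedaEquiv_naturality' (X := X) (Y := Y)
      (yoneda.map p.2 ≫ Sigma.ι (fun t => yoneda.obj (B t)) p.1) g).symm
    change yonedaEquiv (yoneda.map (g.unop ≫ p.2) ≫ Sigma.ι (fun t => yoneda.obj (B t)) p.1) = _
    rw [Functor.map_comp, Category.assoc]

theorem to_ofSigmaPsh {K : Type u} [Category.{v} K] {T : Type v} (B : T → K) :
    toSigmaPsh B ≫ ofSigmaPsh B = 𝟙 _ := by
  refine Sigma.hom_ext _ _ fun t => ?_
  apply yonedaEquiv.injective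
  simp only [toSigmaPsh, Sigma.ι_desc_assoc, Category.comp_id, yonedaEquiv_comp,
    Equiv.apply_symm_apply]
  change yonedaEquiv (yoneda.map (𝟙 (B t)) ≫ Sigma.ι (fun t => yoneda.obj (B t)) t) = _
  simp

theorem map_toSigmaPsh {K : Type u} [Category.{v} K] {T : Type v} (B : T → K) {X : K}
    (p : Σ t : T, X ⟶ B t) :
    yonedaEquiv ((yoneda.map p.2 ≫ Sigma.ι (fun t => yoneda.obj (B t)) p.1) ≫ toSigmaPsh B)
      = p := by
  simp only [toSigmaPsh, Category.assoc, Sigma.ι_desc, yonedaEquiv_symm_naturality_left,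
    Equiv.apply_symm_apply]
  change (⟨p.1, p.2 ≫ 𝟙 _⟩ : Σ t : T, X ⟶ B t) = p
  simp

theorem incl_injective {K : Type u} [Category.{v} K] {T : Type v} (B : T → K) {X : K}
    (p q : Σ t : T, X ⟶ B t)
    (h : yoneda.map p.2 ≫ Sigma.ι (fun t => yoneda.obj (B t)) p.1 =
      yoneda.map q.2 ≫ Sigma.ι (fun t => yoneda.obj (B t)) q.1) : p = q := by
  rw [← map_toSigmaPsh B p, h, map_toSigmaPsh]

theorem incl_surjective {K : Type u} [Category.{v} K] {T : Type v} (B : T → K) {X : K}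
    (g : yoneda.obj X ⟶ ∐ fun t => yoneda.obj (B t)) :
    ∃ p : Σ t : T, X ⟶ B t,
      yoneda.map p.2 ≫ Sigma.ι (fun t => yoneda.obj (B t)) p.1 = g := by
  refine ⟨yonedaEquiv (g ≫ toSigmaPsh B), ?_⟩
  apply yonedaEquiv.injective
  have : g = g ≫ toSigmaPsh B ≫ ofSigmaPsh B := by rw [to_ofSigmaPsh, Category.comp_id]
  conv_rhs => rw [this, ← Category.assoc, yonedaEquiv_comp]
  rfl

theorem forward_aux (K : Type u) [Category.{v} K]
    (I J : Type v) (A : I → J → K) (h : HasProduct (fun i : I => famObj (A i))) (φ : I → J) :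
    HasMultiProduct.{v} (fun i : I => A i (φ i)) := by
  obtain ⟨T, Q, ⟨e⟩⟩ := (∏ᶜ (fun i : I => famObj (A i))).property
  let pr : ∀ i, (∐ fun t => yoneda.obj (Q t)) ⟶ ∐ fun j => yoneda.obj (A i j) :=
    fun i => e.inv ≫ (Pi.π (fun i : I => famObj (A i)) i).hom
  -- universal property of the product, on representables
  have key : ∀ (X : K) (g : ∀ i, yoneda.obj X ⟶ ∐ fun j => yoneda.obj (A i j)),
      ∃ h : yoneda.obj X ⟶ ∐ fun t => yoneda.obj (Q t), (∀ i, h ≫ pr i = g i) ∧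
        ∀ h', (∀ i, h' ≫ pr i = g i) → h' = h := by
    intro X g
    let Y : SigmaCompletion K := ⟨yoneda.obj X, ⟨PUnit, fun _ => X,
      ⟨{ hom := Sigma.ι (fun _ : PUnit => yoneda.obj X) PUnit.unit
         inv := Sigma.desc fun _ => 𝟙 _
         hom_inv_id := by simp
         inv_hom_id := by
          refine Sigma.hom_ext _ _ fun t => ?_
          simp }⟩⟩⟩
    let g' : ∀ i, Y ⟶ famObj (A i) := fun i => ObjectProperty.homMk (g i)
    refine ⟨(Pi.lift g').hom ≫ e.hom, fun i => ?_, fun h' hh' => ?_⟩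
    · have h0 : (Pi.lift g').hom ≫ (Pi.π (fun i : I => famObj (A i)) i).hom = g i :=
        congrArg (fun k => k.hom) (Pi.lift_π g' i)
      simp only [pr, Category.assoc]
      exact (congrArg (fun z => (Pi.lift g').hom ≫ z) (Iso.hom_inv_id_assoc e _)).trans h0
    · have : (ObjectProperty.homMk (h' ≫ e.inv) : Y ⟶ ∏ᶜ (fun i : I => famObj (A i)))
          = Pi.lift g' := by
        refine Pi.hom_ext _ _ fun i => ?_
        rw [Pi.lift_π]
        apply ObjectProperty.hom_ext
        exact (Category.assoc _ _ _).trans (hh' i)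
      rw [← this]
      simp
  refine ⟨Σ t : T, {π : ∀ i, Q t ⟶ A i (φ i) // ∀ i,
    yoneda.map (π i) ≫ Sigma.ι (fun j => yoneda.obj (A i j)) (φ i) =
      Sigma.ι (fun t => yoneda.obj (Q t)) t ≫ pr i}, fun t => Q t.1, fun t i => t.2.1 i, ?_⟩
  intro X f
  obtain ⟨h, h1, h2⟩ := key X fun i =>
    yoneda.map (f i) ≫ Sigma.ι (fun j => yoneda.obj (A i j)) (φ i)
  obtain ⟨⟨t, k⟩, rfl⟩ := incl_surjective Q h
  have ex : ∀ i, ∃ π : Q t ⟶ A i (φ i),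
      yoneda.map π ≫ Sigma.ι (fun j => yoneda.obj (A i j)) (φ i) =
      Sigma.ι (fun t => yoneda.obj (Q t)) t ≫ pr i ∧ k ≫ π = f i := by
    intro i
    obtain ⟨⟨j, π⟩, hπ⟩ := incl_surjective (A i) (Sigma.ι (fun t => yoneda.obj (Q t)) t ≫ pr i)
    have h3 := h1 i
    rw [Category.assoc, ← hπ] at h3
    have h4 := incl_injective (A i) ⟨j, k ≫ π⟩ ⟨φ i, f i⟩ (by simpa using h3)
    obtain ⟨rfl, h5⟩ := Sigma.mk.inj h4
    exact ⟨π, hπ, eq_of_heq h5⟩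
  choose π hπ hk using ex
  refine ⟨⟨⟨t, π, hπ⟩, k⟩, hk, ?_⟩
  rintro ⟨⟨t', π', hπ'⟩, k'⟩ hq
  have h6 := h2 (yoneda.map k' ≫ Sigma.ι (fun t => yoneda.obj (Q t)) t') (fun i => by
    rw [Category.assoc, ← hπ' i, ← hq i]; simp)
  have h7 := incl_injective Q ⟨t', k'⟩ ⟨t, k⟩ h6
  obtain ⟨rfl, h8⟩ := Sigma.mk.inj h7
  obtain rfl := eq_of_heq h8
  obtain rfl : π' = π := by
    funext i
    have h9 := incl_injective (A i) ⟨φ i, π' i⟩ ⟨φ i, π i⟩ ((hπ' i).trans (hπ i).symm)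
    exact eq_of_heq (Sigma.mk.inj h9).2
  rfl

theorem backward_aux (K : Type u) [Category.{v} K] (I J : Type v) (A : I → J → K)
    (H : ∀ φ : I → J, HasMultiProduct.{v} (fun i : I => A i (φ i))) :
    HasProduct (fun i : I => famObj (A i)) := by
  choose T P π hP using H
  let B : (Σ φ : I → J, T φ) → K := fun x => P x.1 x.2
  let pr : ∀ i, (∐ fun x => yoneda.obj (B x)) ⟶ ∐ fun j => yoneda.obj (A i j) := fun i =>
    Sigma.desc fun x => yoneda.map (π x.1 x.2 i) ≫ Sigma.ι (fun j => yoneda.obj (A i j)) (x.1 i)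
  have hpr : ∀ i x (X : K) (k : X ⟶ B x),
      (yoneda.map k ≫ Sigma.ι (fun x => yoneda.obj (B x)) x) ≫ pr i =
      yoneda.map (k ≫ π x.1 x.2 i) ≫ Sigma.ι (fun j => yoneda.obj (A i j)) (x.1 i) := by
    intro i x X k
    simp [pr]
  have key : ∀ (X : K) (g : ∀ i, yoneda.obj X ⟶ ∐ fun j => yoneda.obj (A i j)),
      ∃ h : yoneda.obj X ⟶ ∐ fun x => yoneda.obj (B x), (∀ i, h ≫ pr i = g i) ∧
        ∀ h', (∀ i, h' ≫ pr i = g i) → h' = h := by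
    intro X g
    choose p hp using fun i => incl_surjective (A i) (g i)
    obtain ⟨φ, f, rfl⟩ : ∃ (φ : I → J) (f : ∀ i, X ⟶ A i (φ i)), p = fun i => ⟨φ i, f i⟩ :=
      ⟨fun i => (p i).1, fun i => (p i).2, rfl⟩
    obtain ⟨⟨t, k⟩, h1, h2⟩ := hP φ X f
    refine ⟨yoneda.map k ≫ Sigma.ι (fun x => yoneda.obj (B x)) ⟨φ, t⟩, fun i => ?_, ?_⟩
    · rw [hpr i ⟨φ, t⟩ X k, ← hp i]
      exact congrArg (fun z => yoneda.map z ≫ _) (h1 i)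
    · intro h' hh'
      obtain ⟨⟨⟨φ', t'⟩, k'⟩, rfl⟩ := incl_surjective B h'
      have h3 : ∀ i, (⟨φ' i, k' ≫ π φ' t' i⟩ : Σ j, X ⟶ A i j) = ⟨φ i, f i⟩ := fun i =>
        incl_injective (A i) _ _ (((hpr i ⟨φ', t'⟩ X k').symm.trans (hh' i)).trans (hp i).symm)
      obtain rfl : φ' = φ := funext fun i => (Sigma.mk.inj (h3 i)).1
      have h4 := h2 ⟨t', k'⟩ fun i => eq_of_heq (Sigma.mk.inj (h3 i)).2
      obtain ⟨rfl, h5⟩ := Sigma.mk.inj h4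
      obtain rfl := eq_of_heq h5
      rfl
  have raw : ∀ (S : Kᵒᵖ ⥤ Type v) (_ : IsCoproductOfRepresentables S)
      (g : ∀ i, S ⟶ ∐ fun j => yoneda.obj (A i j)),
      ∃ h : S ⟶ ∐ fun x => yoneda.obj (B x), (∀ i, h ≫ pr i = g i) ∧
        ∀ h', (∀ i, h' ≫ pr i = g i) → h' = h := by
    rintro S ⟨R, Q, ⟨e⟩⟩ g
    choose h h1 h2 using fun r : R => key (Q r) fun i =>
      Sigma.ι (fun r => yoneda.obj (Q r)) r ≫ e.inv ≫ g i
    refine ⟨e.hom ≫ Limits.Sigma.desc h, fun i => ?_, fun h' hh' => ?_⟩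
    · rw [Category.assoc, ← Iso.eq_inv_comp]
      refine Sigma.hom_ext _ _ fun r => ?_
      rw [Sigma.ι_desc_assoc, h1]
    · rw [← Iso.inv_comp_eq]
      refine Sigma.hom_ext _ _ fun r => ?_
      rw [Sigma.ι_desc]
      apply h2
      intro i
      rw [← hh' i]
      simp only [Category.assoc]
  have main : ∀ (S : SigmaCompletion K) (g : ∀ i, S ⟶ famObj (A i)),
      ∃ h : S ⟶ famObj B,
        (∀ i, h ≫ (ObjectProperty.homMk (pr i) : famObj B ⟶ famObj (A i)) = g i) ∧
        ∀ h' : S ⟶ famObj B,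
          (∀ i, h' ≫ (ObjectProperty.homMk (pr i) : famObj B ⟶ famObj (A i)) = g i) → h' = h := by
    intro S g
    obtain ⟨h, h1, h2⟩ := raw S.obj S.property fun i => (g i).hom
    exact ⟨ObjectProperty.homMk h, fun i => ObjectProperty.hom_ext _ (h1 i), fun h' hh' =>
      ObjectProperty.hom_ext _ (h2 h'.hom fun i => congrArg (fun k => k.hom) (hh' i))⟩
  choose l hl hl' using main
  exact ⟨⟨⟨Fan.mk (famObj B) fun i => ObjectProperty.homMk (pr i),
    Fan.IsLimit.mk _ (fun g => l _ g.proj) (fun g i => hl _ g.proj i)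
      (fun g m hm => hl' _ g.proj m hm)⟩⟩⟩

/-- Lemma 2.5: a family of objects `(A_{ij})_{j ∈ J}` (`i ∈ I`) of `Σ𝒦`
has a product in `Σ𝒦` iff for every `φ : I → J` the family `(A_{iφ(i)})_{i ∈ I}` has a
multi-product in `𝒦`. -/
theorem sigmaCompletion_hasProduct_iff_multiProducts (K : Type u) [Category.{v} K]
    (I J : Type v) (A : I → J → K) :
    HasProduct (fun i : I => famObj (A i)) ↔
      ∀ φ : I → J, HasMultiProduct.{v} (fun i : I => A i (φ i)) := by
  exact ⟨forward_aux K I J A, backward_aux K I J A⟩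
end FreeCompletions
end

section
/- Let 𝒦 be a category with finite products. Then the free coproduct completion Σ𝒦 is cartesian closed if and only if 𝒦 is cartesian multi-closed and has multi-products. -/
/- Common definitions for formalizing "How nice are free completions of categories?"
   by Adámek and Rosický. -/

open CategoryTheory CategoryTheory.Limits

universe w w₁ w₂ v₁ u₁

namespace FreeCompletions

universe v u

section Helpers

variable {K : Type u} [Category.{v} K]

theorem pmap_id (F : Kᵒᵖ ⥤ Type v) {X : K} (x : F.obj (Opposite.op X)) :
    F.map (𝟙 X).op x = x := by simp

theorem pmap_comp (F : Kᵒᵖ ⥤ Type v) {X Y Z : K} (f : X ⟶ Y) (g : Y ⟶ Z)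
    (x : F.obj (Opposite.op Z)) :
    F.map (f ≫ g).op x = F.map f.op (F.map g.op x) := by simp

theorem pnat {F G : Kᵒᵖ ⥤ Type v} (α : F ⟶ G) {X Y : K} (f : X ⟶ Y)
    (x : F.obj (Opposite.op Y)) :
    α.app _ (F.map f.op x) = G.map f.op (α.app _ x) := by
  exact NatTrans.naturality_apply α f.op x

/-- Constructor for presheaves. -/
def psh (obj : K → Type v) (map : ∀ {X Y : K}, (X ⟶ Y) → obj Y → obj X)
    (hid : ∀ X (x : obj X), map (𝟙 X) x = x)
    (hcomp : ∀ {X Y Z : K} (f : X ⟶ Y) (g : Y ⟶ Z) (x : obj Z),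
      map (f ≫ g) x = map f (map g x)) : Kᵒᵖ ⥤ Type v where
  obj X := obj X.unop
  map f := ↾(fun x => map f.unop x)
  map_id X := by ext x; exact hid _ x
  map_comp f g := by ext x; exact hcomp _ _ x

/-- Constructor for morphisms of presheaves. -/
def pshHom {F G : Kᵒᵖ ⥤ Type v} (app : ∀ X : K, F.obj (Opposite.op X) → G.obj (Opposite.op X))
    (h : ∀ {X Y : K} (f : X ⟶ Y) (x : F.obj (Opposite.op Y)),
      app X (F.map f.op x) = G.map f.op (app Y x)) : F ⟶ G where
  app X := ↾(app X.unop)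
  naturality X Y f := by ext x; exact h f.unop x

@[simp]
theorem pshHom_app {F G : Kᵒᵖ ⥤ Type v}
    (app : ∀ X : K, F.obj (Opposite.op X) → G.obj (Opposite.op X)) (h)
    (X : K) (x : F.obj (Opposite.op X)) :
    (pshHom (F := F) (G := G) app h).app (Opposite.op X) x = app X x := rfl

theorem psh_hom_ext {F G : Kᵒᵖ ⥤ Type v} {α β : F ⟶ G}
    (h : ∀ (X : K) (x : F.obj (Opposite.op X)), α.app _ x = β.app _ x) : α = β := by
  ext X x
  exact h X.unop x

theorem psh_isIso {F G : Kᵒᵖ ⥤ Type v} (α : F ⟶ G)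
    (h : ∀ X : K, Function.Bijective (fun x : F.obj (Opposite.op X) => α.app _ x)) :
    IsIso α := by
  rw [NatTrans.isIso_iff_isIso_app]
  intro X
  rw [isIso_iff_bijective]
  exact h X.unop

/-- `(A, x)` is a universal family of elements of the presheaf `F`. -/
def Univ (F : Kᵒᵖ ⥤ Type v) {I : Type v} (A : I → K) (x : ∀ i, F.obj (Opposite.op (A i))) :
    Prop :=
  ∀ (X : K) (y : F.obj (Opposite.op X)),
    ∃! p : Σ i, X ⟶ A i, F.map p.2.op (x p.1) = y

/-- `F` has a universal family of elements. -/
def MultiRep (F : Kᵒᵖ ⥤ Type v) : Prop :=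
  ∃ (I : Type v) (A : I → K) (x : ∀ i, F.obj (Opposite.op (A i))), Univ F A x

/-- Concrete coproduct of representables. -/
def sig {I : Type v} (A : I → K) : Kᵒᵖ ⥤ Type v :=
  psh (fun X => Σ i, X ⟶ A i) (fun f p => ⟨p.1, f ≫ p.2⟩) (by simp) (by simp)

theorem sig_map {I : Type v} (A : I → K) {X Y : K} (f : X ⟶ Y) (p : Σ i, Y ⟶ A i) :
    (sig A).map f.op p = (⟨p.1, f ≫ p.2⟩ : Σ i, X ⟶ A i) := rfl

theorem sig_univ {I : Type v} (A : I → K) :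
    Univ (sig A) A (fun i => (⟨i, 𝟙 _⟩ : Σ j, A i ⟶ A j)) := by
  intro X y
  refine ⟨y, ?_, ?_⟩
  · obtain ⟨i, f⟩ := y
    change (⟨i, f ≫ 𝟙 _⟩ : Σ j, X ⟶ A j) = ⟨i, f⟩
    rw [Category.comp_id]
  · rintro ⟨i, f⟩ h
    change (⟨i, f ≫ 𝟙 _⟩ : Σ j, X ⟶ A j) = y at h
    rw [Category.comp_id] at h
    exact h

theorem Univ.of_iso {F G : Kᵒᵖ ⥤ Type v} (e : F ≅ G) {I : Type v} {A : I → K} {x}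
    (h : Univ F A x) : Univ G A (fun i => e.hom.app _ (x i)) := by
  intro X y
  obtain ⟨p, hp, hu⟩ := h X (e.inv.app _ y)
  refine ⟨p, ?_, ?_⟩
  · dsimp only
    rw [← pnat, hp]; simp
  · intro q hq
    apply hu
    dsimp only at hq ⊢
    rw [← hq, ← pnat]
    simp

/-- The coproduct cofan of `sig A`. -/
def sigCofan {I : Type v} (A : I → K) : Cofan (fun i => yoneda.obj (A i)) :=
  Cofan.mk (sig A) (fun i => pshHom (fun X f => (⟨i, f⟩ : Σ j, X ⟶ A j))
    (by intro X Y f x; rfl))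

/-- `sig A` is the coproduct. -/
def sigCofanIsColimit {I : Type v} (A : I → K) : IsColimit (sigCofan A) :=
  Cofan.IsColimit.mk _
    (fun s => pshHom (fun X (p : Σ j, X ⟶ A j) => (s.inj p.1).app _ p.2)
      (by intro X Y f p; exact pnat (s.inj p.1) f p.2))
    (by intro s j; apply psh_hom_ext; intro X x; rfl)
    (by
      intro s m h
      apply psh_hom_ext
      rintro X ⟨i, x⟩
      have := h i
      have := congrArg (fun α => α.app (Opposite.op X) x) this
      exact this)

theorem univ_iso {F : Kᵒᵖ ⥤ Type v} {I : Type v} {A : I → K} {x} (h : Univ F A x) :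
    Nonempty (sig A ≅ F) := by
  let α : sig A ⟶ F := pshHom (fun X (p : Σ i, X ⟶ A i) => F.map p.2.op (x p.1)) (by
    intro X Y f p
    exact pmap_comp F f p.2 _)
  have : IsIso α := by
    apply psh_isIso
    intro X
    rw [Function.bijective_iff_existsUnique]
    exact h X
  exact ⟨asIso α⟩

theorem isCop_iff (F : Kᵒᵖ ⥤ Type v) : IsCoproductOfRepresentables F ↔ MultiRep F := by
  constructor
  · rintro ⟨I, A, ⟨e⟩⟩
    exact ⟨I, A, _, (sig_univ A).of_iso
      (((sigCofanIsColimit A).coconePointUniqueUpToIso (coproductIsCoproduct _)) ≪≫ e.symm)⟩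
  · rintro ⟨I, A, x, h⟩
    obtain ⟨e⟩ := univ_iso h
    exact ⟨I, A, ⟨e.symm ≪≫
      ((sigCofanIsColimit A).coconePointUniqueUpToIso (coproductIsCoproduct _))⟩⟩

theorem MultiRep.of_iso {F G : Kᵒᵖ ⥤ Type v} (e : F ≅ G) (h : MultiRep F) : MultiRep G := by
  obtain ⟨I, A, x, h⟩ := h
  exact ⟨I, A, _, h.of_iso e⟩

/-- Pointwise binary product. -/
def pr (F G : Kᵒᵖ ⥤ Type v) : Kᵒᵖ ⥤ Type v :=
  psh (fun X => F.obj (Opposite.op X) × G.obj (Opposite.op X))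
    (fun f p => (F.map f.op p.1, G.map f.op p.2)) (by simp) (by simp)

theorem pr_map (F G : Kᵒᵖ ⥤ Type v) {X Y : K} (f : X ⟶ Y)
    (p : F.obj (Opposite.op Y) × G.obj (Opposite.op Y)) :
    (pr F G).map f.op p = (F.map f.op p.1, G.map f.op p.2) := rfl

/-- Pointwise indexed product. -/
def ppi {I : Type v} (G : I → Kᵒᵖ ⥤ Type v) : Kᵒᵖ ⥤ Type v :=
  psh (fun X => ∀ i, (G i).obj (Opposite.op X))
    (fun f p i => (G i).map f.op (p i)) (by simp) (by simp)

/-- The constant point presheaf. -/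
def pone : Kᵒᵖ ⥤ Type v :=
  psh (fun _ => PUnit) (fun _ p => p) (by simp) (by simp)

section FP

variable [HasFiniteProducts K]

/-- The presheaf `X ↦ G (A ⨯ X)`. -/
noncomputable def shift (A : K) (G : Kᵒᵖ ⥤ Type v) : Kᵒᵖ ⥤ Type v :=
  psh (fun X => G.obj (Opposite.op (A ⨯ X)))
    (fun f p => G.map (prod.map (𝟙 A) f).op p)
    (by intro X x; simp)
    (by
      intro X Y Z f g x
      rw [← pmap_comp]; simp)

theorem shift_map (A : K) (G : Kᵒᵖ ⥤ Type v) {X Y : K} (f : X ⟶ Y)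
    (p : G.obj (Opposite.op (A ⨯ Y))) :
    (shift A G).map f.op p = G.map (prod.map (𝟙 A) f).op p := rfl

theorem multiRep_pone : MultiRep (pone : Kᵒᵖ ⥤ Type v) := by
  refine ⟨PUnit, fun _ => ⊤_ K, fun _ => PUnit.unit, ?_⟩
  intro X y
  refine ⟨⟨PUnit.unit, terminal.from X⟩, rfl, ?_⟩
  rintro ⟨⟨⟩, f⟩ _
  congr 1
  exact Subsingleton.elim _ _

theorem multiRep_pr {F G : Kᵒᵖ ⥤ Type v} (hF : MultiRep F) (hG : MultiRep G) :
    MultiRep (pr F G) := by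
  obtain ⟨I, A, x, hx⟩ := hF
  obtain ⟨J, B, y, hy⟩ := hG
  refine ⟨I × J, fun p => A p.1 ⨯ B p.2,
    fun p => (F.map prod.fst.op (x p.1), G.map prod.snd.op (y p.2)), ?_⟩
  rintro X ⟨a, b⟩
  obtain ⟨⟨i, f⟩, hp, hpu⟩ := hx X a
  obtain ⟨⟨j, g⟩, hq, hqu⟩ := hy X b
  refine ⟨⟨(i, j), prod.lift f g⟩, ?_, ?_⟩
  · dsimp only at *
    rw [pr_map, ← pmap_comp, ← pmap_comp]
    rw [prod.lift_fst, prod.lift_snd, hp, hq]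
  · rintro ⟨⟨i', j'⟩, h⟩ hh
    dsimp only at *
    rw [pr_map, ← pmap_comp, ← pmap_comp] at hh
    have h1 := hpu ⟨i', h ≫ prod.fst⟩ (congrArg Prod.fst hh)
    have h2 := hqu ⟨j', h ≫ prod.snd⟩ (congrArg Prod.snd hh)
    cases h1
    cases h2
    congr 1
    apply Limits.prod.hom_ext
    · rw [prod.lift_fst]
    · rw [prod.lift_snd]

/-- multi-closedness transports `MultiRep` along `shift`. -/
theorem multiRep_shift (hK : CartesianMultiClosedOf K) (A : K) {G : Kᵒᵖ ⥤ Type v}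
    (hG : MultiRep G) : MultiRep (shift A G) := by
  obtain ⟨J, B, y, hy⟩ := hG
  choose I E ev hev using fun j => hK A (B j)
  refine ⟨Σ j, I j, fun p => E p.1 p.2, fun p => G.map (ev p.1 p.2).op (y p.1), ?_⟩
  intro X a
  obtain ⟨⟨j, c⟩, hc, hcu⟩ := hy _ a
  obtain ⟨⟨i, g⟩, hg, hgu⟩ := hev j X c
  refine ⟨⟨⟨j, i⟩, g⟩, ?_, ?_⟩
  · dsimp only at *
    rw [shift_map, ← pmap_comp, hg, hc]
  · rintro ⟨⟨j', i'⟩, g'⟩ hh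
    dsimp only at *
    rw [shift_map, ← pmap_comp] at hh
    have h1 := hcu ⟨j', _⟩ hh
    cases h1
    have h2 := hgu ⟨i', g'⟩ rfl
    cases h2
    rfl

end FP

theorem multiRep_ppi (hK : HasMultiProducts K) {I : Type v} {G : I → Kᵒᵖ ⥤ Type v}
    (hG : ∀ i, MultiRep (G i)) : MultiRep (ppi G) := by
  choose J B y hy using hG
  choose T P π hπ using fun j : ∀ i, J i => hK I (fun i => B i (j i))
  refine ⟨Σ j, T j, fun p => P p.1 p.2, fun p i => (G i).map (π p.1 p.2 i).op (y i (p.1 i)), ?_⟩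
  intro X a
  choose q hq hqu using fun i => hy i X (a i)
  obtain ⟨⟨t, h⟩, hh, hhu⟩ := hπ (fun i => (q i).1) X (fun i => (q i).2)
  refine ⟨⟨⟨_, t⟩, h⟩, ?_, ?_⟩
  · funext i
    change (G i).map h.op ((G i).map (π _ t i).op _) = a i
    rw [← pmap_comp]
    have := hh i
    dsimp only at this
    rw [this]
    exact hq i
  · rintro ⟨⟨j', t'⟩, h'⟩ hh'
    have key : ∀ i, (⟨j' i, h' ≫ π j' t' i⟩ : Σ k, X ⟶ B i k) = q i := by
      intro i
      apply hqu i
      have := congrFun hh' i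
      dsimp only
      rw [pmap_comp]
      exact this
    have hq' : q = fun i => ⟨j' i, h' ≫ π j' t' i⟩ := by
      funext i; exact (key i).symm
    subst hq'
    have := hhu ⟨t', h'⟩ (fun i => rfl)
    cases this
    rfl



/-- Functoriality of `pr` in the second variable. -/
def prMap (F : Kᵒᵖ ⥤ Type v) {Z W : Kᵒᵖ ⥤ Type v} (ψ : Z ⟶ W) : pr F Z ⟶ pr F W :=
  pshHom (fun X (p : F.obj (Opposite.op X) × Z.obj (Opposite.op X)) =>
    (show F.obj (Opposite.op X) × W.obj (Opposite.op X) from (p.1, ψ.app _ p.2)))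
    (by
      intro X Y f p
      exact Prod.ext rfl (pnat ψ f p.2))

theorem prMap_app (F : Kᵒᵖ ⥤ Type v) {Z W : Kᵒᵖ ⥤ Type v} (ψ : Z ⟶ W) {X : K}
    (a : F.obj (Opposite.op X)) (z : Z.obj (Opposite.op X)) :
    (prMap F ψ).app (Opposite.op X) (a, z) =
      (show F.obj (Opposite.op X) × W.obj (Opposite.op X) from (a, ψ.app _ z)) := rfl

theorem prMap_comp (F : Kᵒᵖ ⥤ Type v) {Z W V : Kᵒᵖ ⥤ Type v} (ψ : Z ⟶ W) (χ : W ⟶ V) :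
    prMap F (ψ ≫ χ) = prMap F ψ ≫ prMap F χ := rfl

/-- `ev` exhibits `E` as an exponential among multi-representable presheaves. -/
def IsExp {F G E : Kᵒᵖ ⥤ Type v} (ev : pr F E ⟶ G) : Prop :=
  ∀ Z : Kᵒᵖ ⥤ Type v, MultiRep Z → ∀ φ : pr F Z ⟶ G, ∃! ψ : Z ⟶ E, prMap F ψ ≫ ev = φ

/-- The map out of a representable given by an element. -/
def yel (F : Kᵒᵖ ⥤ Type v) {X : K} (e : F.obj (Opposite.op X)) : yoneda.obj X ⟶ F :=
  pshHom (fun Y (f : Y ⟶ X) => F.map f.op e) (by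
    intro Y Z g f
    exact pmap_comp F g f e)

theorem yel_id (F : Kᵒᵖ ⥤ Type v) {X : K} (e : F.obj (Opposite.op X)) :
    (yel F e).app (Opposite.op X) (𝟙 X) = e := pmap_id F e

theorem yel_eq {F : Kᵒᵖ ⥤ Type v} {X : K} (α : yoneda.obj X ⟶ F) :
    α = yel F (α.app (Opposite.op X) (𝟙 X)) := by
  apply psh_hom_ext
  intro Y (f : Y ⟶ X)
  have h := pnat α f (𝟙 X)
  have h2 : (yoneda.obj X).map f.op (𝟙 X) = f := Category.comp_id f
  rw [h2] at h
  exact h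

theorem multiRep_yoneda (X : K) : MultiRep (yoneda.obj X) := by
  refine ⟨PUnit, fun _ => X, fun _ => 𝟙 X, ?_⟩
  intro Y (y : Y ⟶ X)
  refine ⟨⟨PUnit.unit, y⟩, Category.comp_id y, ?_⟩
  rintro ⟨⟨⟩, f⟩ h
  have : f ≫ 𝟙 X = y := h
  rw [Category.comp_id] at this
  rw [this]

theorem IsExp.iso {F G E E' : Kᵒᵖ ⥤ Type v} {ev : pr F E ⟶ G} {ev' : pr F E' ⟶ G}
    (h : IsExp ev) (h' : IsExp ev') (hE : MultiRep E) : Nonempty (E ≅ E') := by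
  obtain ⟨α, hα, -⟩ := h' E hE ev
  have : IsIso α := by
    apply psh_isIso
    intro X
    constructor
    · intro e₁ e₂ he
      have hu := (h _ (multiRep_yoneda X) (prMap F (yel E e₁) ≫ ev)).unique rfl
        (y₂ := yel E e₂) (by
          rw [← hα, ← Category.assoc, ← Category.assoc, ← prMap_comp, ← prMap_comp]
          congr 2
          rw [yel_eq (yel E e₁ ≫ α), yel_eq (yel E e₂ ≫ α)]
          congr 1
          change α.app _ ((yel E e₂).app _ (𝟙 X)) = α.app _ ((yel E e₁).app _ (𝟙 X))
          rw [yel_id, yel_id]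
          exact he.symm)
      have := congrArg (fun β => β.app (Opposite.op X) (𝟙 X)) hu
      dsimp only at this
      rw [yel_id, yel_id] at this
      exact this
    · intro e
      obtain ⟨ψ, hψ, -⟩ := h _ (multiRep_yoneda X) (prMap F (yel E' e) ≫ ev')
      have hu := (h' _ (multiRep_yoneda X) (prMap F (yel E' e) ≫ ev')).unique rfl
        (y₂ := ψ ≫ α) (by
          rw [prMap_comp, Category.assoc, hα, hψ])
      refine ⟨ψ.app _ (𝟙 X), ?_⟩
      have := congrArg (fun β => β.app (Opposite.op X) (𝟙 X)) hu
      dsimp only at this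
      rw [yel_id] at this
      exact this.symm
  exact ⟨asIso α⟩

section FP2

variable [HasFiniteProducts K]

/-- The exponential `G ^ (∐ A i)`. -/
noncomputable def expo {I : Type v} (A : I → K) (G : Kᵒᵖ ⥤ Type v) : Kᵒᵖ ⥤ Type v :=
  ppi (fun i => shift (A i) G)

theorem expo_map {I : Type v} (A : I → K) (G : Kᵒᵖ ⥤ Type v) {X Y : K} (f : X ⟶ Y)
    (e : ∀ i, G.obj (Opposite.op (A i ⨯ Y))) (i : I) :
    (show ∀ i, G.obj (Opposite.op (A i ⨯ X)) from (expo A G).map f.op e) i =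
      G.map (prod.map (𝟙 (A i)) f).op (e i) := rfl

theorem exists_ev {F : Kᵒᵖ ⥤ Type v} {I : Type v} {A : I → K} {x} (h : Univ F A x)
    (G : Kᵒᵖ ⥤ Type v) : ∃ ev : pr F (expo A G) ⟶ G,
      ∀ (X : K) (i : I) (f : X ⟶ A i) (e : ∀ i, G.obj (Opposite.op (A i ⨯ X))),
        ev.app (Opposite.op X)
          (show F.obj (Opposite.op X) × (expo A G).obj (Opposite.op X) from
            (F.map f.op (x i), e)) = G.map (prod.lift f (𝟙 X)).op (e i) := by
  choose c hc hcu using h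
  let evf : ∀ X, F.obj (Opposite.op X) → (∀ i, G.obj (Opposite.op (A i ⨯ X))) →
      G.obj (Opposite.op X) :=
    fun X a e => G.map (prod.lift (c X a).2 (𝟙 X)).op (e (c X a).1)
  have evs : ∀ (X : K) (i : I) (f : X ⟶ A i) (e : ∀ i, G.obj (Opposite.op (A i ⨯ X))),
      evf X (F.map f.op (x i)) e = G.map (prod.lift f (𝟙 X)).op (e i) := by
    intro X i f e
    have := hcu X _ ⟨i, f⟩ rfl
    simp only [evf]
    rw [← this]
  refine ⟨pshHom (fun X (p : F.obj (Opposite.op X) × (expo A G).obj (Opposite.op X)) =>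
    evf X p.1 p.2) ?_, evs⟩
  rintro X Y g ⟨a, e⟩
  change evf X (F.map g.op a) ((expo A G).map g.op e) = G.map g.op (evf Y a e)
  obtain ⟨⟨i, f⟩, hf⟩ : ∃ p : Σ i, Y ⟶ A i, F.map p.2.op (x p.1) = a := ⟨c Y a, hc Y a⟩
  dsimp only at hf
  subst hf
  rw [← pmap_comp, evs Y i f e]
  refine (evs X i (g ≫ f) ((expo A G).map g.op e)).trans ?_
  obtain ⟨d, hd⟩ : ∃ d : G.obj (Opposite.op (A i ⨯ Y)), d = e i := ⟨_, rfl⟩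
  change G.map _ (G.map (prod.map (𝟙 (A i)) g).op (e i)) = G.map _ (G.map _ (e i))
  rw [← hd, ← pmap_comp, ← pmap_comp]
  have : prod.lift (g ≫ f) (𝟙 X) ≫ prod.map (𝟙 (A i)) g = g ≫ prod.lift f (𝟙 Y) := by
    rw [prod.lift_map, prod.comp_lift]
    simp
  rw [this]

theorem exists_isExp {F : Kᵒᵖ ⥤ Type v} {I : Type v} {A : I → K} {x} (h : Univ F A x)
    (G : Kᵒᵖ ⥤ Type v) : ∃ ev : pr F (expo A G) ⟶ G, IsExp ev := by
  obtain ⟨ev, hev⟩ := exists_ev h G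
  refine ⟨ev, ?_⟩
  intro Z _ φ
  let ψf : ∀ X, Z.obj (Opposite.op X) → ∀ i, G.obj (Opposite.op (A i ⨯ X)) :=
    fun X z i => φ.app (Opposite.op (A i ⨯ X))
      (show F.obj (Opposite.op (A i ⨯ X)) × Z.obj (Opposite.op (A i ⨯ X)) from
        (F.map prod.fst.op (x i), Z.map prod.snd.op z))
  have φnat : ∀ {X Y : K} (f : X ⟶ Y) (a : F.obj (Opposite.op Y)) (z : Z.obj (Opposite.op Y)),
      G.map f.op (φ.app (Opposite.op Y)
        (show F.obj (Opposite.op Y) × Z.obj (Opposite.op Y) from (a, z))) =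
      φ.app (Opposite.op X) (show F.obj (Opposite.op X) × Z.obj (Opposite.op X) from
        (F.map f.op a, Z.map f.op z)) := by
    intro X Y f a z
    exact (pnat φ f _).symm
  refine ⟨pshHom ψf ?_, ?_, ?_⟩
  · intro X Y f z
    funext i
    change φ.app _ _ = G.map (prod.map (𝟙 (A i)) f).op (φ.app _ _)
    rw [φnat, ← pmap_comp, ← pmap_comp, ← pmap_comp]
    simp only [prod.map_fst, prod.map_snd, Category.comp_id]
  · apply psh_hom_ext
    rintro X ⟨a, z⟩
    obtain ⟨⟨i, f⟩, hf, -⟩ := h X a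
    dsimp only at hf
    subst hf
    refine (hev X i f (ψf X z)).trans ?_
    change G.map _ (φ.app _ _) = _
    rw [φnat, ← pmap_comp, ← pmap_comp, prod.lift_fst, prod.lift_snd, pmap_id]
  · intro ψ hψ
    apply psh_hom_ext
    intro X z
    funext i
    change _ = φ.app _ _
    rw [← hψ]
    have h1 := hev (A i ⨯ X) i prod.fst (ψ.app _ (Z.map prod.snd.op z))
    refine Eq.trans ?_ h1.symm
    rw [pnat]
    obtain ⟨d, hd⟩ : ∃ d : G.obj (Opposite.op (A i ⨯ X)), d = ψ.app (Opposite.op X) z i :=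
      ⟨_, rfl⟩
    change ψ.app (Opposite.op X) z i =
      G.map _ (G.map (prod.map (𝟙 (A i)) prod.snd).op (ψ.app (Opposite.op X) z i))
    rw [← hd, ← pmap_comp]
    have : prod.lift prod.fst (𝟙 (A i ⨯ X)) ≫ prod.map (𝟙 (A i)) prod.snd = 𝟙 (A i ⨯ X) := by
      rw [prod.lift_map, Category.comp_id, Category.id_comp]
      apply Limits.prod.hom_ext
      · rw [prod.lift_fst, Category.id_comp]
      · rw [prod.lift_snd, Category.id_comp]
    rw [this]
    exact (pmap_id G _).symm

theorem multiClosed_of (h : ∀ {I : Type v} (A : I → K) {G : Kᵒᵖ ⥤ Type v}, MultiRep G →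
    MultiRep (expo A G)) : CartesianMultiClosedOf K := by
  intro A B
  obtain ⟨I, E, x, hx⟩ := h (fun _ : PUnit => A) (multiRep_yoneda B)
  refine ⟨I, E, fun i => x i PUnit.unit, ?_⟩
  intro X c
  obtain ⟨p, hp, hu⟩ := hx X (fun _ => c)
  refine ⟨p, congrFun hp PUnit.unit, ?_⟩
  intro q hq
  apply hu
  funext i
  exact hq

theorem multiProducts_of (h : ∀ {I : Type v} (A : I → K) {G : Kᵒᵖ ⥤ Type v}, MultiRep G →
    MultiRep (expo A G)) : HasMultiProducts K := by
  intro I A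
  obtain ⟨T, P, x, hx⟩ := h (fun _ : I => ⊤_ K) (G := sig A) ⟨_, _, _, sig_univ A⟩
  let x' : ∀ t (_ : I), Σ j, (⊤_ K) ⨯ P t ⟶ A j := x
  let s : ∀ X : K, X ⟶ (⊤_ K) ⨯ X := fun X => prod.lift (terminal.from X) (𝟙 X)
  have hs : ∀ X, prod.snd ≫ s X = 𝟙 _ := by
    intro X
    apply Limits.prod.hom_ext
    · exact Subsingleton.elim _ _
    · simp only [s]
      rw [Category.assoc, prod.lift_snd, Category.comp_id, Category.id_comp]
  have hs' : ∀ X, s X ≫ prod.snd = 𝟙 _ := fun X => prod.lift_snd _ _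
  have hsn : ∀ {X Y : K} (f : X ⟶ Y), s X ≫ prod.map (𝟙 _) f = f ≫ s Y := by
    intro X Y f
    apply Limits.prod.hom_ext
    · exact Subsingleton.elim _ _
    · simp [s]
  have key : ∀ (X : K) (y : ∀ _ : I, Σ j, (⊤_ K) ⨯ X ⟶ A j), ∃! p : Σ t, X ⟶ P t,
      ∀ i, (⟨(x' p.1 i).1, prod.map (𝟙 _) p.2 ≫ (x' p.1 i).2⟩ : Σ j, (⊤_ K) ⨯ X ⟶ A j) = y i := by
    intro X y
    obtain ⟨p, hp, hu⟩ := hx X y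
    exact ⟨p, fun i => congrFun hp i, fun q hq => hu q (funext hq)⟩
  let π : ∀ (t : {t : T // ∀ i, (x' t i).1 = i}) (i : I), P t.1 ⟶ A i :=
    fun t i => s _ ≫ (x' t.1 i).2 ≫ eqToHom (congrArg A (t.2 i))
  have hπ : ∀ (t : {t : T // ∀ i, (x' t i).1 = i}) (i : I) {X : K} (f : X ⟶ P t.1),
      (⟨(x' t.1 i).1, prod.map (𝟙 _) f ≫ (x' t.1 i).2⟩ : Σ j, (⊤_ K) ⨯ X ⟶ A j) =
        ⟨i, prod.snd ≫ f ≫ π t i⟩ := by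
    intro t i X f
    have e1 : (prod.snd : (⊤_ K) ⨯ X ⟶ X) ≫ f ≫ π t i =
        (prod.map (𝟙 _) f ≫ (x' t.1 i).2) ≫ eqToHom (congrArg A (t.2 i)) := by
      simp only [π]
      rw [← Category.assoc f, ← hsn, Category.assoc, ← Category.assoc prod.snd, hs]
      simp
    rw [e1]
    have hgen : ∀ {W : K} (j : I) (hj : j = i) (g : W ⟶ A j),
        (⟨j, g⟩ : Σ j, W ⟶ A j) = ⟨i, g ≫ eqToHom (congrArg A hj)⟩ := by
      intro W j hj g
      subst hj
      simp
    exact hgen _ (t.2 i) _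
  refine ⟨{t : T // ∀ i, (x' t i).1 = i}, fun t => P t.1, π, ?_⟩
  intro X f
  obtain ⟨⟨t, g⟩, hp, hu⟩ := key X (fun i => ⟨i, prod.snd ≫ f i⟩)
  have ht : ∀ i, (x' t i).1 = i := fun i => congrArg Sigma.fst (hp i)
  refine ⟨⟨⟨t, ht⟩, g⟩, ?_, ?_⟩
  · intro i
    have h1 := (hπ ⟨t, ht⟩ i g).symm.trans (hp i)
    have h2 := eq_of_heq (Sigma.mk.inj h1).2
    have h3 := congrArg (fun k => s X ≫ k) h2
    dsimp only at h3
    rw [← Category.assoc (s X), ← Category.assoc (s X), hs', Category.id_comp,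
      Category.id_comp] at h3
    exact h3
  · rintro ⟨t', g'⟩ hq
    have h1 := hu ⟨t'.1, g'⟩ (by
      intro i
      dsimp only
      rw [hπ t' i g']
      have := hq i
      dsimp only at this
      rw [this])
    obtain ⟨t', ht'⟩ := t'
    cases h1
    rfl

open MonoidalCategory CartesianMonoidalCategory

/-- The product in `Σ K`. -/
def sprod (F G : SigmaCompletion K) : SigmaCompletion K :=
  ⟨pr F.obj G.obj, (isCop_iff _).2
    (multiRep_pr ((isCop_iff _).1 F.property) ((isCop_iff _).1 G.property))⟩

/-- First projection. -/
def sfst (F G : SigmaCompletion K) : sprod F G ⟶ F :=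
  ObjectProperty.homMk (pshHom
    (fun X (p : F.obj.obj (Opposite.op X) × G.obj.obj (Opposite.op X)) => p.1)
    (by intro X Y f p; rfl))

/-- Second projection. -/
def ssnd (F G : SigmaCompletion K) : sprod F G ⟶ G :=
  ObjectProperty.homMk (pshHom
    (fun X (p : F.obj.obj (Opposite.op X) × G.obj.obj (Opposite.op X)) => p.2)
    (by intro X Y f p; rfl))

/-- Pairing. -/
def slift {Z F G : SigmaCompletion K} (f : Z ⟶ F) (g : Z ⟶ G) : Z ⟶ sprod F G :=
  ObjectProperty.homMk (pshHom
    (fun X z => (show F.obj.obj (Opposite.op X) × G.obj.obj (Opposite.op X) from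
      (f.hom.app _ z, g.hom.app _ z)))
    (by intro X Y k z; exact Prod.ext (pnat f.hom k z) (pnat g.hom k z)))

theorem slift_fst {Z F G : SigmaCompletion K} (f : Z ⟶ F) (g : Z ⟶ G) :
    slift f g ≫ sfst F G = f := rfl

theorem slift_snd {Z F G : SigmaCompletion K} (f : Z ⟶ F) (g : Z ⟶ G) :
    slift f g ≫ ssnd F G = g := rfl

theorem sprod_ext {Z F G : SigmaCompletion K} {f g : Z ⟶ sprod F G}
    (h1 : f ≫ sfst F G = g ≫ sfst F G) (h2 : f ≫ ssnd F G = g ≫ ssnd F G) : f = g := by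
  apply ObjectProperty.hom_ext
  apply psh_hom_ext
  intro X z
  refine Prod.ext ?_ ?_
  · exact congrArg (fun k => k.hom.app (Opposite.op X) z) h1
  · exact congrArg (fun k => k.hom.app (Opposite.op X) z) h2

/-- Functoriality of the product. -/
def smap (F : SigmaCompletion K) {Z W : SigmaCompletion K} (ψ : Z ⟶ W) :
    sprod F Z ⟶ sprod F W := ObjectProperty.homMk (prMap F.obj ψ.hom)

theorem smap_fst (F : SigmaCompletion K) {Z W : SigmaCompletion K} (ψ : Z ⟶ W) :
    smap F ψ ≫ sfst F W = sfst F Z := rfl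

theorem smap_snd (F : SigmaCompletion K) {Z W : SigmaCompletion K} (ψ : Z ⟶ W) :
    smap F ψ ≫ ssnd F W = ssnd F Z ≫ ψ := rfl

/-- The terminal object of `Σ K`. -/
def sone : SigmaCompletion K := ⟨pone, (isCop_iff _).2 multiRep_pone⟩

/-- `sone` is terminal. -/
def soneIsTerminal : IsTerminal (sone : SigmaCompletion K) :=
  IsTerminal.ofUniqueHom
    (fun F => ObjectProperty.homMk (pshHom (fun _ _ => PUnit.unit) (by intro X Y f x; rfl)))
    (by
      intro F m
      apply ObjectProperty.hom_ext
      apply psh_hom_ext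
      intro X x
      rfl)

/-- The cartesian structure on `Σ K`. -/
@[reducible]
def sigmaCartesian : CartesianMonoidalCategory (SigmaCompletion K) :=
  CartesianMonoidalCategory.ofChosenFiniteProducts
    ⟨_, soneIsTerminal⟩
    (fun F G => ⟨BinaryFan.mk (sfst F G) (ssnd F G),
      BinaryFan.IsLimit.mk _ (fun f g => slift f g)
        (fun f g => slift_fst f g) (fun f g => slift_snd f g)
        (fun f g m h1 h2 => sprod_ext h1 h2)⟩)

section Cart

variable [CartesianMonoidalCategory (SigmaCompletion K)]

/-- Comparison of products. -/
def theta (F Z : SigmaCompletion K) : F ⊗ Z ≅ sprod F Z where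
  hom := slift (fst F Z) (snd F Z)
  inv := lift (sfst F Z) (ssnd F Z)
  hom_inv_id := by
    apply CartesianMonoidalCategory.hom_ext
    · rw [Category.assoc, lift_fst, slift_fst, Category.id_comp]
    · rw [Category.assoc, lift_snd, slift_snd, Category.id_comp]
  inv_hom_id := by
    apply sprod_ext
    · rw [Category.assoc, slift_fst, lift_fst, Category.id_comp]
    · rw [Category.assoc, slift_snd, lift_snd, Category.id_comp]

theorem theta_nat (F : SigmaCompletion K) {Z W : SigmaCompletion K} (ψ : Z ⟶ W) :
    F ◁ ψ ≫ (theta F W).hom = (theta F Z).hom ≫ smap F ψ := by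
  apply sprod_ext
  · simp only [Category.assoc, theta]
    rw [slift_fst, smap_fst, slift_fst, whiskerLeft_fst]
  · simp only [Category.assoc, theta]
    rw [slift_snd, smap_snd, ← Category.assoc, slift_snd, whiskerLeft_snd]

theorem closed_iff (F : SigmaCompletion K) : (tensorLeft F).IsLeftAdjoint ↔
    ∀ G : SigmaCompletion K, ∃ (E : SigmaCompletion K) (ev : sprod F E ⟶ G),
      ∀ (Z : SigmaCompletion K) (φ : sprod F Z ⟶ G), ∃! ψ : Z ⟶ E, smap F ψ ≫ ev = φ := by
  constructor
  · intro _ G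
    let adj := Adjunction.ofIsLeftAdjoint (tensorLeft F)
    refine ⟨(tensorLeft F).rightAdjoint.obj G, (theta F _).inv ≫ adj.counit.app G, ?_⟩
    intro Z φ
    have key : ∀ ψ : Z ⟶ (tensorLeft F).rightAdjoint.obj G,
        smap F ψ ≫ (theta F _).inv ≫ adj.counit.app G = φ ↔
          (adj.homEquiv Z G).symm ψ = (theta F Z).hom ≫ φ := by
      intro ψ
      rw [Adjunction.homEquiv_counit, ← cancel_epi (theta F Z).hom, ← Category.assoc,
        ← theta_nat]
      simp
    refine ⟨adj.homEquiv Z G ((theta F Z).hom ≫ φ), ?_, ?_⟩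
    · exact (key _).2 (by simp)
    · intro ψ hψ
      rw [← (key ψ).1 hψ]
      simp
  · intro h
    have : ∀ G, HasTerminal (CostructuredArrow (tensorLeft F) G) := by
      intro G
      obtain ⟨E, ev, hE⟩ := h G
      have key : ∀ (Z : SigmaCompletion K) (φ : F ⊗ Z ⟶ G),
          ∃! ψ : Z ⟶ E, F ◁ ψ ≫ (theta F E).hom ≫ ev = φ := by
        intro Z φ
        have key2 : ∀ ψ : Z ⟶ E, F ◁ ψ ≫ (theta F E).hom ≫ ev = φ ↔
            smap F ψ ≫ ev = (theta F Z).inv ≫ φ := by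
          intro ψ
          rw [← Category.assoc, theta_nat, ← cancel_epi (theta F Z).inv]
          simp
        obtain ⟨ψ, h1, h2⟩ := hE Z ((theta F Z).inv ≫ φ)
        exact ⟨ψ, (key2 ψ).2 h1, fun ψ' h' => h2 ψ' ((key2 ψ').1 h')⟩
      choose c hc hcu using key
      refine IsTerminal.hasTerminal (X := CostructuredArrow.mk
        (show (tensorLeft F).obj E ⟶ G from (theta F E).hom ≫ ev)) ?_
      refine IsTerminal.ofUniqueHom
        (fun B => CostructuredArrow.homMk (c B.left B.hom) (hc B.left B.hom)) ?_
      intro B m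
      apply CostructuredArrow.hom_ext
      exact hcu B.left B.hom m.left (CostructuredArrow.w m)
    exact isLeftAdjoint_of_costructuredArrowTerminals _

theorem closed_iff' (F : SigmaCompletion K) {I : Type v} {A : I → K} {x}
    (hx : Univ F.obj A x) : (tensorLeft F).IsLeftAdjoint ↔
    ∀ G : Kᵒᵖ ⥤ Type v, MultiRep G → MultiRep (expo A G) := by
  rw [closed_iff]
  constructor
  · intro h G hG
    obtain ⟨E, ev, hE⟩ := h ⟨G, (isCop_iff G).2 hG⟩
    obtain ⟨ev', hev'⟩ := exists_isExp hx G
    have h1 : IsExp (F := F.obj) (G := G) (E := E.obj) ev.hom := by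
      intro Z hZ φ
      obtain ⟨ψ, h1, h2⟩ := hE ⟨Z, (isCop_iff Z).2 hZ⟩ (ObjectProperty.homMk φ)
      refine ⟨ψ.hom, congrArg (fun k => k.hom) h1, ?_⟩
      intro ψ' h'
      exact congrArg (fun k => k.hom)
        (h2 (ObjectProperty.homMk ψ') (ObjectProperty.hom_ext _ h'))
    have hEm := (isCop_iff _).1 E.property
    obtain ⟨e⟩ := h1.iso hev' hEm
    exact hEm.of_iso e
  · intro h G
    obtain ⟨ev, hev⟩ := exists_isExp hx G.obj
    refine ⟨⟨expo A G.obj, (isCop_iff _).2 (h _ ((isCop_iff _).1 G.property))⟩,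
      ObjectProperty.homMk ev, ?_⟩
    intro Z φ
    obtain ⟨ψ, h1, h2⟩ := hev Z.obj ((isCop_iff _).1 Z.property) φ.hom
    refine ⟨ObjectProperty.homMk ψ, ObjectProperty.hom_ext _ h1, ?_⟩
    intro ψ' h'
    exact ObjectProperty.hom_ext _ (h2 ψ'.hom (congrArg (fun k => k.hom) h'))

end Cart

theorem main_aux : CartesianClosedP (SigmaCompletion K) ↔
      CartesianMultiClosedOf K ∧ HasMultiProducts K := by
  constructor
  · rintro ⟨h, ⟨hc⟩⟩
    have key : ∀ {I : Type v} (A : I → K) {G : Kᵒᵖ ⥤ Type v}, MultiRep G →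
        MultiRep (expo A G) := by
      intro I A G hG
      let F : SigmaCompletion K := ⟨sig A, (isCop_iff _).2 ⟨_, _, _, sig_univ A⟩⟩
      exact (closed_iff' F (sig_univ A)).1 ⟨_, ⟨(hc.closed F).adj⟩⟩ G hG
    exact ⟨multiClosed_of key, multiProducts_of key⟩
  · rintro ⟨h1, h2⟩
    let _ := sigmaCartesian (K := K)
    refine ⟨inferInstance, ⟨⟨fun F => ?_⟩⟩⟩
    have : (tensorLeft F).IsLeftAdjoint := by
      obtain ⟨I, A, x, hx⟩ := (isCop_iff _).1 F.property
      exact (closed_iff' F hx).2 fun G hG =>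
        multiRep_ppi h2 fun i => multiRep_shift h1 (A i) hG
    exact ⟨_, Adjunction.ofIsLeftAdjoint (tensorLeft F)⟩

end FP2

end Helpers

/-- Theorem 2.9: for `𝒦` with finite products, `Σ𝒦` is cartesian closed
iff `𝒦` is cartesian multi-closed and has multi-products. -/
theorem sigmaCompletion_cartesianClosed_iff (K : Type u) [Category.{v} K]
    [HasFiniteProducts K] :
    CartesianClosedP (SigmaCompletion K) ↔
      CartesianMultiClosedOf K ∧ HasMultiProducts K := by
  exact main_aux
end FreeCompletions
end
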